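/- Let R be a commutative ring and (A, D_G) a 1-tilting cotorsion pair with associated Gabriel topology G such that R is G-almost perfect (R_G is a perfect ring and R/J is a perfect ring for every J ∈ G). Then R_G ⊕ R_G/R is a 1-tilting module associated to (A, D_G), the module R_G ⊕ R_G/R is Σ-pure-split, and consequently the class A is closed under direct limits. -/

import Mathlib

universe u

/-- A Gabriel topology on a commutative ring `R`: a filter of ideals of `R`
satisfying the Gabriel axiom T4. -/
structure GabrielTopology (R : Type u) [CommRing R] : Type u where
  sets : Set (Ideal R)
  top_mem : (⊤ : Ideal R) ∈ sets
  mem_of_le : ∀ {I J : Ideal R}, I ∈ sets → I ≤ J → J ∈ sets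
  inf_mem : ∀ {I J : Ideal R}, I ∈ sets → J ∈ sets → I ⊓ J ∈ sets
  gabriel : ∀ I J : Ideal R, J ∈ sets →
    (∀ r ∈ J, Submodule.colon I (Ideal.span {r}) ∈ sets) → I ∈ sets

namespace GabrielTopology

variable {R : Type u} [CommRing R] (G : GabrielTopology R)

/-- A module `M` is `G`-torsion if the annihilator of every element belongs to `G`. -/
def IsTorsion (M : Type u) [AddCommGroup M] [Module R M] : Prop :=
  ∀ x : M, Ideal.torsionOf R M x ∈ G.sets

/-- A module `M` is `G`-torsion-free if no nonzero element is annihilated by an ideal of `G`. -/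
def IsTorsionFree (M : Type u) [AddCommGroup M] [Module R M] : Prop :=
  ∀ x : M, Ideal.torsionOf R M x ∈ G.sets → x = 0

/-- A module `M` is `G`-divisible if `JM = M` for every `J ∈ G`. -/
def IsDivisible (M : Type u) [AddCommGroup M] [Module R M] : Prop :=
  ∀ J ∈ G.sets, J • (⊤ : Submodule R M) = ⊤

/-- `G` is faithful if `R` is `G`-torsion-free. -/
def Faithful : Prop := ∀ r : R, Ideal.torsionOf R R r ∈ G.sets → r = 0

/-- `G` is finitely generated if it has a basis of finitely generated ideals. -/
def FinitelyGenerated : Prop := ∀ J ∈ G.sets, ∃ J' ∈ G.sets, J' ≤ J ∧ J'.FG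

end GabrielTopology

/-- `Ext¹_R(M, N) = 0`, expressed by the standard characterisation:
every short exact sequence `0 → N → E → M → 0` splits. -/
def Ext1Vanish (R : Type u) [CommRing R] (M N : Type u) [AddCommGroup M] [Module R M]
    [AddCommGroup N] [Module R N] : Prop :=
  ∀ (E : Type u) [AddCommGroup E] [Module R E] (i : N →ₗ[R] E) (p : E →ₗ[R] M),
    Function.Injective i → Function.Surjective p → LinearMap.range i = LinearMap.ker p →
      ∃ s : M →ₗ[R] E, p ∘ₗ s = LinearMap.id

/-- `M` has projective dimension at most 1: the kernel of a free cover is projective. -/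
def ProjDimLE1 (R : Type u) [CommRing R] (M : Type u) [AddCommGroup M] [Module R M] : Prop :=
  ∃ (ι : Type u) (p : (ι →₀ R) →ₗ[R] M),
    Function.Surjective p ∧ Module.Projective R ↥(LinearMap.ker p)

/-- `M ∈ Add(T)`: `M` is a direct summand of a direct sum of copies of `T`. -/
def InAdd (R : Type u) [CommRing R] (T M : Type u) [AddCommGroup T] [Module R T]
    [AddCommGroup M] [Module R M] : Prop :=
  ∃ (ι : Type u) (s : M →ₗ[R] (ι →₀ T)) (r : (ι →₀ T) →ₗ[R] M), r ∘ₗ s = LinearMap.id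

/-- `T` is a 1-tilting module: (T1) `p.dim T ≤ 1`, (T2) `Ext¹(T, T^(κ)) = 0` for all κ,
(T3) there is an exact sequence `0 → R → T₀ → T₁ → 0` with `T₀, T₁ ∈ Add(T)`. -/
def Is1Tilting (R : Type u) [CommRing R] (T : Type u) [AddCommGroup T] [Module R T] : Prop :=
  ProjDimLE1 R T ∧
  (∀ ι : Type u, Ext1Vanish R T (ι →₀ T)) ∧
  ∃ (T0 T1 : ModuleCat.{u} R) (i : R →ₗ[R] ↥T0) (p : ↥T0 →ₗ[R] ↥T1),
    InAdd R T ↥T0 ∧ InAdd R T ↥T1 ∧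
    Function.Injective i ∧ Function.Surjective p ∧ LinearMap.range i = LinearMap.ker p

namespace GabrielTopology

variable {R : Type u} [CommRing R] (G : GabrielTopology R)

/-- `(𝒜, 𝒟_G)` is a 1-tilting cotorsion pair with associated Gabriel topology `G`:
`G` is a faithful finitely generated Gabriel topology and the class of `G`-divisible
modules is the tilting class of a 1-tilting module. -/
def IsTiltingTopology : Prop :=
  G.Faithful ∧ G.FinitelyGenerated ∧
  ∃ T : ModuleCat.{u} R, Is1Tilting R ↥T ∧
    ∀ (M : Type u) [AddCommGroup M] [Module R M], (Ext1Vanish R ↥T M ↔ G.IsDivisible M)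

/-- Membership in the left-hand class `𝒜 = ᗮ(𝒟_G)` of the 1-tilting cotorsion pair. -/
def MemA (M : Type u) [AddCommGroup M] [Module R M] : Prop :=
  ∀ (D : Type u) [AddCommGroup D] [Module R D], G.IsDivisible D → Ext1Vanish R M D

/-- The class `𝒜` is covering: every module has an `𝒜`-cover. -/
def IsACovering : Prop :=
  ∀ (M : Type u) [AddCommGroup M] [Module R M],
    ∃ (C : ModuleCat.{u} R) (φ : ↥C →ₗ[R] M),
      G.MemA ↥C ∧
      (∀ (C' : Type u) [AddCommGroup C'] [Module R C'], G.MemA C' →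
        ∀ f : C' →ₗ[R] M, ∃ g : C' →ₗ[R] ↥C, φ ∘ₗ g = f) ∧
      (∀ e : ↥C →ₗ[R] ↥C, φ ∘ₗ e = φ → Function.Bijective e)

/-- The class `𝒜` is closed under direct limits. -/
def AClosedUnderDirectLimits : Prop :=
  ∀ (ι : Type u) [Preorder ι] [IsDirected ι (· ≤ ·)] [Nonempty ι] [DecidableEq ι]
    (M : ι → Type u) [∀ i, AddCommGroup (M i)] [∀ i, Module R (M i)]
    (f : ∀ i j, i ≤ j → M i →ₗ[R] M j) [DirectedSystem M fun i j h => f i j h],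
    (∀ i, G.MemA (M i)) → G.MemA (Module.DirectLimit M f)

/-- `Q`, via `algebraMap R Q`, is the ring of quotients `R_G` of `R` with respect to `G`:
`Q` is `G`-torsion-free and `G`-injective (i.e. `G`-closed) and the kernel and cokernel
of `R → Q` are `G`-torsion. -/
structure IsRingOfQuotients (Q : Type u) [CommRing Q] [Algebra R Q] : Prop where
  torsionFree : ∀ q : Q, Ideal.torsionOf R Q q ∈ G.sets → q = 0
  gInjective : ∀ J ∈ G.sets, ∀ f : ↥J →ₗ[R] Q, ∃ q : Q, ∀ j : ↥J, f j = (j : R) • q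
  ker_torsion : ∀ r : R, algebraMap R Q r = 0 → Ideal.torsionOf R R r ∈ G.sets
  coker_torsion : ∀ q : Q, ∃ J ∈ G.sets, ∀ x ∈ J, ∃ r : R, x • q = algebraMap R Q r

/-- `G` is a perfect Gabriel topology, realised by the perfect localisation `Q`:
`R → Q` is a flat ring epimorphism and `G = {J ∣ JQ = Q}`. -/
def IsPerfectLocalization (Q : Type u) [CommRing Q] [Algebra R Q] : Prop :=
  Module.Flat R Q ∧
  (∀ (S : Type u) [CommRing S] (f g : Q →+* S),
    f.comp (algebraMap R Q) = g.comp (algebraMap R Q) → f = g) ∧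
  (∀ J : Ideal R, J ∈ G.sets ↔ J • (⊤ : Submodule R Q) = ⊤)

end GabrielTopology

/-- A commutative ring is perfect iff every flat module is projective. -/
def IsPerfectRing (S : Type u) [CommRing S] : Prop :=
  ∀ (M : Type u) [AddCommGroup M] [Module S M], Module.Flat S M → Module.Projective S M

/-- `X` is Σ-pure-split: every pure embedding `A ⊆ B` with `B ∈ Add(X)` splits. -/
def SigmaPureSplit (R : Type u) [CommRing R] (X : Type u) [AddCommGroup X] [Module R X] : Prop :=
  ∀ (A B : Type u) [AddCommGroup A] [Module R A] [AddCommGroup B] [Module R B] (i : A →ₗ[R] B),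
    Function.Injective i →
    (∀ (M : Type u) [AddCommGroup M] [Module R M], Function.Injective (LinearMap.rTensor M i)) →
    InAdd R X B → ∃ r : B →ₗ[R] A, r ∘ₗ i = LinearMap.id

/-- A concrete model of `Ext¹_R(M, N)`, computed from the canonical free presentation
`0 → S → (M →₀ R) → M → 0` of `M` as `coker (Hom((M →₀ R), N) → Hom(S, N))`. -/
abbrev ext1 (R : Type u) [CommRing R] (M N : Type u) [AddCommGroup M] [Module R M]
    [AddCommGroup N] [Module R N] : Type u :=
  (↥(LinearMap.ker (Finsupp.linearCombination R (id : M → M))) →ₗ[R] N) ⧸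
    LinearMap.range
      (LinearMap.lcomp R N (LinearMap.ker (Finsupp.linearCombination R (id : M → M))).subtype)

/-- A concrete model of `Tor₁^R(M, N)`, computed from the canonical free presentation
`0 → S → (M →₀ R) → M → 0` of `M` as `ker (S ⊗ N → (M →₀ R) ⊗ N)`. -/
abbrev tor1 (R : Type u) [CommRing R] (M N : Type u) [AddCommGroup M] [Module R M]
    [AddCommGroup N] [Module R N] : Type u :=
  ↥(LinearMap.ker
    (LinearMap.rTensor N (LinearMap.ker (Finsupp.linearCombination R (id : M → M))).subtype))

/-- The cokernel `U/R` of a ring map `R → U`. -/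
abbrev cokerAlg (R U : Type u) [CommRing R] [CommRing U] [Algebra R U] : Type u :=
  U ⧸ LinearMap.range (Algebra.linearMap R U)

/-- A linear topology on a commutative ring `R`, given by its filter of open ideals. -/
structure LinearTopologyOn (R : Type u) [CommRing R] : Type u where
  sets : Set (Ideal R)
  top_mem : (⊤ : Ideal R) ∈ sets
  mem_of_le : ∀ {I J : Ideal R}, I ∈ sets → I ≤ J → J ∈ sets
  inf_mem : ∀ {I J : Ideal R}, I ∈ sets → J ∈ sets → I ⊓ J ∈ sets

/-- An `R`-module `M` is `H`-discrete if the annihilator of every element is open. -/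
def LinearTopologyOn.IsDiscrete {R : Type u} [CommRing R] (H : LinearTopologyOn R)
    (M : Type u) [AddCommGroup M] [Module R M] : Prop :=
  ∀ x : M, Ideal.torsionOf R M x ∈ H.sets

/-- `R` is `H`-h-local: every open ideal is contained in only finitely many maximal ideals,
and every open prime ideal is contained in only one maximal ideal. -/
def LinearTopologyOn.IsHLocal {R : Type u} [CommRing R] (H : LinearTopologyOn R) : Prop :=
  (∀ J ∈ H.sets, {m : Ideal R | m.IsMaximal ∧ J ≤ m}.Finite) ∧
  (∀ p ∈ H.sets, p.IsPrime →
    ∀ m n : Ideal R, m.IsMaximal → n.IsMaximal → p ≤ m → p ≤ n → m = n)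

/-- Over `S`, `M` admits a resolution of length `n` by finitely generated projectives. -/
def FGProjDimLE (S : Type u) [CommRing S] :
    ℕ → ∀ (M : Type u) [AddCommGroup M] [Module S M], Prop
  | 0, M, iA, iM =>
      letI := iA; letI := iM
      Module.Finite S M ∧ Module.Projective S M
  | n + 1, M, iA, iM =>
      letI := iA; letI := iM
      ∃ (k : ℕ) (f : (Fin k → S) →ₗ[S] M),
        Function.Surjective f ∧ FGProjDimLE S n ↥(LinearMap.ker f)

open TensorProduct

/-- A module is flat if each of its linear relations lifts to some flat module. -/
theorem flat_of_lift_relations {A : Type*} [CommRing A] {N : Type*} [AddCommGroup N] [Module A N]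
    (h : ∀ (l : ℕ) (r : Fin l → A) (y : Fin l → N), ∑ i, r i • y i = 0 →
      ∃ (B : Type u) (_ : AddCommGroup B) (_ : Module A B) (_ : Module.Flat A B)
        (g : B →ₗ[A] N) (y' : Fin l → B), (∀ i, g (y' i) = y i) ∧ ∑ i, r i • y' i = 0) :
    Module.Flat A N := by
  refine Module.Flat.of_forall_isTrivialRelation fun {l r y} hry => ?_
  obtain ⟨B, _, _, _, g, y', hy', hr⟩ := h l r y hry
  obtain ⟨k, a, z, hz, ha⟩ := Module.Flat.isTrivialRelation_of_sum_smul_eq_zero hr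
  refine ⟨k, a, fun j => g (z j), fun i => ?_, ha⟩
  rw [← hy' i, hz i, map_sum]
  simp

/-- Bass: over a perfect ring, the descending chain of principal ideals generated by the partial
products of a sequence is stationary. -/
theorem IsPerfectRing.exists_prod_eq {A : Type u} [CommRing A] (hA : IsPerfectRing A)
    (a : ℕ → A) : ∃ (n : ℕ) (c : A),
      ∏ k ∈ Finset.range n, a k = c * ∏ k ∈ Finset.range (n + 1), a k := by
  classical
  let f : ∀ i j : ℕ, i ≤ j → A →ₗ[A] A := fun i j _ => (∏ k ∈ Finset.Ico i j, a k) • LinearMap.id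
  have hf : ∀ i j (h : i ≤ j) (x : A), f i j h x = (∏ k ∈ Finset.Ico i j, a k) * x := by
    intro i j h x; simp [f]
  have : DirectedSystem (fun _ : ℕ => A) fun i j h => f i j h :=
    { map_self := fun i x => by simp [f]
      map_map := fun k j i hij hjk x => by
        rw [hf, hf, hf, ← mul_assoc, mul_comm (∏ l ∈ Finset.Ico _ _, a l),
          Finset.prod_Ico_consecutive _ hij hjk]
        all_goals omega }
  let L := Module.DirectLimit (fun _ : ℕ => A) f
  let o : ∀ n, A →ₗ[A] L := fun n => Module.DirectLimit.of A ℕ (fun _ : ℕ => A) f n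
  have ho : ∀ i j, i ≤ j → ∀ x, o i x = o j ((∏ k ∈ Finset.Ico i j, a k) * x) := by
    intro i j h x
    rw [← hf i j h]
    exact (Module.DirectLimit.of_f (R := A) (G := fun _ : ℕ => A) (f := f) (hij := h)).symm
  have hflat : Module.Flat A L := by
    refine flat_of_lift_relations.{u} fun l r y hry => ?_
    have hy : ∀ i, ∃ n x, o n x = y i := fun i => Module.DirectLimit.exists_of (y i)
    choose n x hx using hy
    let N := Finset.univ.sup n
    have hnN : ∀ i, n i ≤ N := fun i => Finset.le_sup (Finset.mem_univ i)
    have h0 : o N (∑ i, r i • ((∏ k ∈ Finset.Ico (n i) N, a k) * x i)) = 0 := by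
      rw [map_sum, ← hry]
      refine Finset.sum_congr rfl fun i _ => ?_
      rw [map_smul, ← ho _ _ (hnN i), hx]
    obtain ⟨m, hm, h1⟩ := Module.DirectLimit.of.zero_exact h0
    refine ⟨A, inferInstance, inferInstance, inferInstance, o m,
      fun i => f N m hm ((∏ k ∈ Finset.Ico (n i) N, a k) * x i), fun i => ?_, ?_⟩
    · simp only [hf]
      rw [← ho _ _ hm, ← ho _ _ (hnN i), hx]
    · rw [← h1, map_sum]
      simp only [map_smul]
  have hproj : Module.Projective A L := hA L hflat
  let π : (ℕ →₀ A) →ₗ[A] L := Finsupp.lsum A o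
  have hπ : Function.Surjective π := by
    intro z
    obtain ⟨n, x, rfl⟩ := Module.DirectLimit.exists_of z
    exact ⟨Finsupp.single n x, by simp [π, o]⟩
  obtain ⟨σ, hσ⟩ := Module.projective_lifting_property π LinearMap.id hπ
  let x := σ (o 0 1)
  have hdiv : ∀ n i, ∃ c, x i = c * ∏ k ∈ Finset.range n, a k := by
    intro n i
    refine ⟨σ (o n 1) i, ?_⟩
    have h2 : o 0 1 = (∏ k ∈ Finset.range n, a k) • o n 1 := by
      rw [ho 0 n (Nat.zero_le n), ← map_smul, Finset.range_eq_Ico, smul_eq_mul]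
    simp only [x]
    rw [h2, map_smul, Finsupp.smul_apply, smul_eq_mul, mul_comm]
  have hπx : π x = o 0 1 := by
    have := LinearMap.congr_fun hσ (o 0 1)
    simpa using this
  let N := x.support.sup id
  have hN : ∀ i ∈ x.support, i ≤ N := fun i hi => Finset.le_sup (f := id) hi
  have h3 : o N (∑ i ∈ x.support, (∏ k ∈ Finset.Ico i N, a k) * x i -
      ∏ k ∈ Finset.Ico 0 N, a k) = 0 := by
    rw [map_sub, sub_eq_zero, map_sum]
    have : o N (∏ k ∈ Finset.Ico 0 N, a k) = o 0 1 := by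
      rw [ho 0 N (Nat.zero_le N), mul_one]
    rw [this, ← hπx]
    simp only [π, Finsupp.lsum_apply, Finsupp.sum]
    exact Finset.sum_congr rfl fun i hi => (ho i N (hN i hi) (x i)).symm
  obtain ⟨n, hn, h4⟩ := Module.DirectLimit.of.zero_exact h3
  change f N n hn _ = 0 at h4
  rw [hf N n hn, mul_sub, sub_eq_zero, mul_comm, mul_comm _ (∏ k ∈ Finset.Ico 0 N, a k),
    Finset.prod_Ico_consecutive _ (Nat.zero_le N) hn] at h4
  choose c hc using hdiv (n + 1)
  refine ⟨n, (∑ i ∈ x.support, (∏ k ∈ Finset.Ico i N, a k) * c i) * ∏ k ∈ Finset.Ico N n, a k, ?_⟩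
  rw [Finset.range_eq_Ico, ← h4, Finset.sum_mul, Finset.sum_mul, Finset.sum_mul]
  refine Finset.sum_congr rfl fun i _ => ?_
  rw [hc i]
  ring

/-- Divisibility modulo `I` satisfies the minimal condition: every nonempty set of elements contains
one whose multiples in the set all divide it modulo `I`. -/
def HasMinimalModulo {A : Type*} [CommRing A] (I : Ideal A) : Prop :=
  ∀ X : Set A, X.Nonempty → ∃ x ∈ X, ∀ y, x * y ∈ X → ∃ c, x - x * y * c ∈ I

theorem IsPerfectRing.hasMinimalModulo_bot {A : Type u} [CommRing A] (hA : IsPerfectRing A) :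
    HasMinimalModulo (⊥ : Ideal A) := by
  classical
  intro X ⟨x₀, hx₀⟩
  by_contra! hcon
  choose y hy hy' using hcon
  let s : ℕ → X := fun n => Nat.rec ⟨x₀, hx₀⟩ (fun _ z => ⟨z.1 * y z.1 z.2, hy z.1 z.2⟩) n
  let a : ℕ → A := fun n => y (s n).1 (s n).2
  have hs : ∀ n, (s n).1 = x₀ * ∏ k ∈ Finset.range n, a k := by
    intro n
    induction n with
    | zero => simp [s]
    | succ n ih => rw [Finset.prod_range_succ, ← mul_assoc, ← ih]
  obtain ⟨n, c, hc⟩ := hA.exists_prod_eq a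
  refine hy' (s n).1 (s n).2 c ?_
  have h1 : (s n).1 * y (s n).1 (s n).2 = (s (n + 1)).1 := rfl
  rw [h1, hs n, hs (n + 1), Ideal.mem_bot]
  linear_combination x₀ * hc

theorem IsPerfectRing.hasMinimalModulo {A : Type u} [CommRing A] {I : Ideal A}
    (hA : IsPerfectRing (A ⧸ I)) : HasMinimalModulo I := by
  intro X hX
  obtain ⟨_, ⟨x, hx, rfl⟩, h⟩ := hA.hasMinimalModulo_bot (Ideal.Quotient.mk I '' X) (hX.image _)
  refine ⟨x, hx, fun y hy => ?_⟩
  obtain ⟨c, hc⟩ := h (Ideal.Quotient.mk I y) ⟨x * y, hy, map_mul _ _ _⟩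
  obtain ⟨c, rfl⟩ := Ideal.Quotient.mk_surjective c
  refine ⟨c, ?_⟩
  rw [← Ideal.Quotient.eq_zero_iff_mem]
  simpa using hc

namespace HasMinimalModulo

variable {A : Type*} [CommRing A] {I : Ideal A}

theorem exists_idempotent (h : HasMinimalModulo I) (m : Ideal A) [m.IsMaximal] (hI : I ≤ m) :
    ∃ f, f ∉ m ∧ f * f - f ∈ I ∧ ∀ y, y ∉ m → ∃ d, f - f * y * d ∈ I := by
  obtain ⟨x, hx, hxy⟩ := h {x | x ∉ m}
    ⟨1, fun h1 => ‹m.IsMaximal›.ne_top ((Ideal.eq_top_iff_one m).2 h1)⟩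
  have hp : m.IsPrime := inferInstance
  have key : ∀ y, y ∉ m → ∃ c, x - x * y * c ∈ I :=
    fun y hy => hxy y fun h' => (hp.mem_or_mem h').elim hx hy
  obtain ⟨u, hu⟩ := key x hx
  refine ⟨x * u, fun h' => hx ?_, ?_, fun y hy => ?_⟩
  · have h2 := m.add_mem (hI hu) (m.mul_mem_left x h')
    ring_nf at h2
    exact h2
  · have h2 := I.mul_mem_left (-u) hu
    ring_nf at h2 ⊢
    exact h2
  · obtain ⟨d, hd⟩ := key y hy
    refine ⟨d, ?_⟩
    have h2 := I.mul_mem_left u hd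
    ring_nf at h2 ⊢
    exact h2

/-- The idempotents isolating the maximal ideals above `I` generate the unit ideal. -/
theorem exists_isolating (h : HasMinimalModulo I) : ∃ F : Finset A,
    (∀ f ∈ F, f * f - f ∈ I ∧ ∃ m : Ideal A, m.IsMaximal ∧ I ≤ m ∧ f ∉ m ∧
      ∀ n : Ideal A, n.IsMaximal → I ≤ n → f ∉ n → n = m) ∧ I ⊔ Ideal.span (F : Set A) = ⊤ := by
  let X : Set A := {f | f * f - f ∈ I ∧ ∃ m : Ideal A, m.IsMaximal ∧ I ≤ m ∧ f ∉ m ∧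
      ∀ n : Ideal A, n.IsMaximal → I ≤ n → f ∉ n → n = m}
  have hX : I ⊔ Ideal.span X = ⊤ := by
    by_contra hne
    obtain ⟨m, hm, hle⟩ := Ideal.exists_le_maximal _ hne
    have hIm : I ≤ m := le_sup_left.trans hle
    obtain ⟨f, hfm, hff, hf⟩ := h.exists_idempotent m hIm
    refine hfm (hle (Ideal.mem_sup_right (Ideal.subset_span ⟨hff, m, hm, hIm, hfm, ?_⟩)))
    intro n hn hIn hfn
    by_contra hnm
    have : ∃ y ∈ n, y ∉ m := by
      by_contra! hall
      exact hnm (hn.eq_of_le hm.ne_top hall)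
    obtain ⟨y, hyn, hym⟩ := this
    obtain ⟨d, hd⟩ := hf y hym
    have h2 := n.add_mem (hIn hd) (n.mul_mem_left (f * d) hyn)
    ring_nf at h2
    exact hfn h2
  rw [Ideal.eq_top_iff_one, Submodule.mem_sup] at hX
  obtain ⟨i, hi, z, hz, hiz⟩ := hX
  obtain ⟨F, hFX, hzF⟩ := Submodule.mem_span_finite_of_mem_span hz
  refine ⟨F, fun f hf => hFX hf, ?_⟩
  rw [Ideal.eq_top_iff_one, Submodule.mem_sup]
  exact ⟨i, hi, z, hzF, hiz⟩

theorem finite_maximal (h : HasMinimalModulo (⊥ : Ideal A)) :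
    {m : Ideal A | m.IsMaximal}.Finite := by
  classical
  obtain ⟨F, hF, htop⟩ := h.exists_isolating
  rw [bot_sup_eq] at htop
  have hex : ∀ m : Ideal A, m.IsMaximal → ∃ f ∈ F, f ∉ m := by
    intro m hm
    by_contra! hall
    exact hm.ne_top (top_le_iff.1 (htop ▸ Ideal.span_le.2 hall))
  let p : Ideal A → A := fun m => if hm : m.IsMaximal then (hex m hm).choose else 0
  have hp : ∀ m : Ideal A, m.IsMaximal → p m ∈ F ∧ p m ∉ m := by
    intro m hm
    simp only [p, dif_pos hm]
    exact (hex m hm).choose_spec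
  refine Set.Finite.of_finite_image (f := p) (F.finite_toSet.subset ?_) ?_
  · rintro _ ⟨m, hm, rfl⟩
    exact (hp m hm).1
  · intro m hm n hn hmn
    obtain ⟨-, m', -, -, -, h'⟩ := hF _ (hp m hm).1
    rw [h' m hm bot_le (hp m hm).2, h' n hn bot_le (hmn ▸ (hp n hn).2)]

/-- In a perfect ring, an ideal with zero annihilator is the unit ideal. -/
theorem eq_top_of_annihilator (h : HasMinimalModulo (⊥ : Ideal A)) (J : Ideal A)
    (hJ : ∀ x, (∀ j ∈ J, x * j = 0) → x = 0) : J = ⊤ := by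
  by_contra hne
  obtain ⟨m, hm, hle⟩ := Ideal.exists_le_maximal _ hne
  obtain ⟨f, hfm, hff, hf⟩ := h.exists_idempotent m bot_le
  simp only [Ideal.mem_bot, sub_eq_zero] at hff hf
  obtain ⟨x, ⟨hx0, hfx⟩, hx⟩ := h {x | x ≠ 0 ∧ f * x = x}
    ⟨f, fun h0 => hfm (h0 ▸ m.zero_mem), hff⟩
  have : ∃ j ∈ J, x * j ≠ 0 := by
    by_contra! hall
    exact hx0 (hJ x hall)
  obtain ⟨j, hj, hxj⟩ := this
  obtain ⟨c, hc⟩ := hx j ⟨hxj, by rw [← mul_assoc, hfx]⟩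
  have hu : 1 - j * c ∉ m := fun h' => hm.ne_top ((Ideal.eq_top_iff_one m).2 (by
    simpa using m.add_mem h' (m.mul_mem_right c (hle hj))))
  obtain ⟨d, hd⟩ := hf _ hu
  rw [Ideal.mem_bot] at hc
  apply hx0
  rw [← hfx, hd]
  linear_combination f * d * hc

end HasMinimalModulo

namespace Ext1Vanish

variable {R : Type u} [CommRing R] {M D : Type u} [AddCommGroup M] [Module R M]
  [AddCommGroup D] [Module R D]

/-- If `Ext¹(M, D) = 0`, maps out of `M` lift along surjections with kernel `D`. -/
theorem exists_lift (h : Ext1Vanish R M D) {E Y : Type u} [AddCommGroup E] [Module R E]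
    [AddCommGroup Y] [Module R Y] (i : D →ₗ[R] E) (p : E →ₗ[R] Y) (hi : Function.Injective i)
    (hp : Function.Surjective p) (hip : LinearMap.range i = LinearMap.ker p) (f : M →ₗ[R] Y) :
    ∃ g : M →ₗ[R] E, p ∘ₗ g = f := by
  let P : Submodule R (E × M) :=
    LinearMap.eqLocus (p ∘ₗ LinearMap.fst R E M) (f ∘ₗ LinearMap.snd R E M)
  have hP : ∀ x : E × M, x ∈ P ↔ p x.1 = f x.2 := fun x => Iff.rfl
  have hpi : ∀ d, p (i d) = 0 := fun d => by
    have : i d ∈ LinearMap.ker p := hip ▸ LinearMap.mem_range_self i d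
    exact this
  let j : D →ₗ[R] P := LinearMap.codRestrict P (LinearMap.inl R E M ∘ₗ i) fun d => by
    rw [hP]; simp [hpi]
  have hj : Function.Injective j := fun a b hab => hi (congrArg (fun x : P => x.1.1) hab)
  have hq : Function.Surjective (LinearMap.snd R E M ∘ₗ P.subtype) := fun m => by
    obtain ⟨e, he⟩ := hp (f m)
    exact ⟨⟨(e, m), he⟩, rfl⟩
  obtain ⟨s, hs⟩ := h P j (LinearMap.snd R E M ∘ₗ P.subtype) hj hq (by
    ext ⟨⟨e, m⟩, hx⟩
    rw [hP] at hx
    constructor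
    · rintro ⟨d, hd⟩
      have : (0 : M) = m := congrArg (fun x : P => x.1.2) hd
      exact this.symm
    · intro h0
      have h0 : m = 0 := h0
      subst h0
      have : e ∈ LinearMap.range i := by
        rw [hip]; simpa using hx
      obtain ⟨d, rfl⟩ := this
      exact ⟨d, rfl⟩)
  refine ⟨LinearMap.fst R E M ∘ₗ P.subtype ∘ₗ s, LinearMap.ext fun m => ?_⟩
  have h1 := (hP _).1 (s m).2
  have h2 : (s m).1.2 = m := LinearMap.congr_fun hs m
  rw [h2] at h1
  exact h1

/-- If `Ext¹(M, D) = 0`, maps into `D` extend along injections with cokernel `M`. -/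
theorem exists_extension (h : Ext1Vanish R M D) {N X : Type u} [AddCommGroup N] [Module R N]
    [AddCommGroup X] [Module R X] (i : N →ₗ[R] X) (p : X →ₗ[R] M) (hi : Function.Injective i)
    (hp : Function.Surjective p) (hip : LinearMap.range i = LinearMap.ker p) (f : N →ₗ[R] D) :
    ∃ g : X →ₗ[R] D, g ∘ₗ i = f := by
  let W : Submodule R (D × X) := LinearMap.range (LinearMap.prod f (-i))
  have hpi : ∀ d, p (i d) = 0 := fun d => by
    have : i d ∈ LinearMap.ker p := hip ▸ LinearMap.mem_range_self i d
    exact this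
  let q : ((D × X) ⧸ W) →ₗ[R] M := W.liftQ (p ∘ₗ LinearMap.snd R D X) (by
    rintro _ ⟨n, rfl⟩
    simp [hpi])
  let j : D →ₗ[R] ((D × X) ⧸ W) := W.mkQ ∘ₗ LinearMap.inl R D X
  have hjker : ∀ z : (D × X) ⧸ W, q z = 0 → ∃ d, j d = z := by
    intro z hz
    obtain ⟨⟨d, x⟩, rfl⟩ := W.mkQ_surjective z
    have hx : x ∈ LinearMap.range i := by rw [hip]; exact hz
    obtain ⟨n, rfl⟩ := hx
    refine ⟨d + f n, ?_⟩
    rw [← sub_eq_zero]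
    simp only [j, LinearMap.comp_apply, ← map_sub]
    rw [← LinearMap.mem_ker, Submodule.ker_mkQ]
    exact ⟨n, by simp⟩
  have hj : Function.Injective j := by
    rw [injective_iff_map_eq_zero]
    intro d hd
    have : LinearMap.inl R D X d ∈ W := by
      rw [← W.ker_mkQ]; exact hd
    obtain ⟨n, hn⟩ := this
    have h1 : -(i n) = 0 := congrArg Prod.snd hn
    have h2 : f n = d := congrArg Prod.fst hn
    have h3 : n = 0 := hi (by simpa using h1)
    rw [← h2, h3, map_zero]
  obtain ⟨s, hs⟩ := h _ j q hj (fun m => by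
      obtain ⟨x, hx⟩ := hp m
      exact ⟨W.mkQ (0, x), hx⟩) (by
      ext z
      constructor
      · rintro ⟨d, rfl⟩
        simp [j, q]
      · intro hz
        exact hjker z hz)
  let e : D ≃ₗ[R] LinearMap.range j := LinearEquiv.ofInjective j hj
  let r : ((D × X) ⧸ W) →ₗ[R] ((D × X) ⧸ W) := LinearMap.id - s ∘ₗ q
  have hr : ∀ z, r z ∈ LinearMap.range j := by
    intro z
    obtain ⟨d, hd⟩ := hjker (r z) (by
      have := LinearMap.congr_fun hs (q z)
      simp only [LinearMap.comp_apply, LinearMap.id_apply] at this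
      simp [r, this])
    exact ⟨d, hd⟩
  refine ⟨e.symm.toLinearMap ∘ₗ LinearMap.codRestrict _ r hr ∘ₗ W.mkQ ∘ₗ LinearMap.inr R D X,
    LinearMap.ext fun n => ?_⟩
  simp only [LinearMap.comp_apply, LinearEquiv.coe_coe]
  rw [LinearEquiv.symm_apply_eq]
  apply Subtype.ext
  have h1 : W.mkQ (LinearMap.inr R D X (i n)) = j (f n) := by
    rw [← sub_eq_zero]
    simp only [j, LinearMap.comp_apply, ← map_sub]
    rw [← LinearMap.mem_ker, Submodule.ker_mkQ]
    exact ⟨-n, by simp⟩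
  have h2 : q (j (f n)) = 0 := by simp [q, j]
  rw [LinearMap.codRestrict_apply, h1]
  simp [r, h2, e]

/-- `Ext¹(M, D) = 0` as soon as maps from the kernel of some `F → M` with `Ext¹(F, D) = 0`
into `D` extend to `F`. -/
theorem of_forall_extension {F : Type u} [AddCommGroup F] [Module R F] (hF : Ext1Vanish R F D)
    (π : F →ₗ[R] M) (hπ : Function.Surjective π)
    (h : ∀ f : LinearMap.ker π →ₗ[R] D, ∃ g : F →ₗ[R] D, ∀ x : LinearMap.ker π, g x = f x) :
    Ext1Vanish R M D := by
  intro E _ _ i p hi hp hip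
  obtain ⟨l, hl⟩ := hF.exists_lift i p hi hp hip π
  let e : D ≃ₗ[R] LinearMap.range i := LinearEquiv.ofInjective i hi
  have hl' : ∀ x : F, p (l x) = π x := fun x => LinearMap.congr_fun hl x
  let l' : LinearMap.ker π →ₗ[R] LinearMap.range i :=
    LinearMap.codRestrict _ (l ∘ₗ (LinearMap.ker π).subtype) fun x => by
      rw [hip, LinearMap.mem_ker]
      exact (hl' x).trans x.2
  obtain ⟨g, hg⟩ := h (e.symm.toLinearMap ∘ₗ l')
  have hig : ∀ x : LinearMap.ker π, i (g x) = l x := by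
    intro x
    rw [hg x]
    have : (e (e.symm (l' x)) : E) = l' x := by rw [e.apply_symm_apply]
    exact this
  have hpi : ∀ d, p (i d) = 0 := fun d => by
    have : i d ∈ LinearMap.ker p := hip ▸ LinearMap.mem_range_self i d
    exact this
  let t : F →ₗ[R] E := l - i ∘ₗ g
  have ht : LinearMap.ker π ≤ LinearMap.ker t := by
    intro x hx
    have := hig ⟨x, hx⟩
    simp only [t, LinearMap.mem_ker, LinearMap.sub_apply, LinearMap.comp_apply]
    rw [sub_eq_zero]
    exact this.symm
  refine ⟨(LinearMap.ker π).liftQ t ht ∘ₗ (π.quotKerEquivOfSurjective hπ).symm.toLinearMap,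
    LinearMap.ext fun m => ?_⟩
  obtain ⟨x, rfl⟩ := hπ m
  have hx : (π.quotKerEquivOfSurjective hπ).symm (π x) = (LinearMap.ker π).mkQ x := by
    rw [LinearEquiv.symm_apply_eq]; rfl
  simp only [LinearMap.comp_apply, LinearEquiv.coe_coe, hx, LinearMap.id_apply]
  simp [t, hpi, hl']

theorem of_projective [Module.Projective R M] : Ext1Vanish R M D :=
  fun _ _ _ _ p _ hp _ => Module.projective_lifting_property p LinearMap.id hp

theorem of_retract (h : Ext1Vanish R M D) {M' : Type u} [AddCommGroup M'] [Module R M']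
    (s : M' →ₗ[R] M) (r : M →ₗ[R] M') (hrs : ∀ x, r (s x) = x) : Ext1Vanish R M' D := by
  intro E _ _ i p hi hp hip
  obtain ⟨g, hg⟩ := h.exists_lift i p hi hp hip r
  refine ⟨g ∘ₗ s, LinearMap.ext fun x => ?_⟩
  have := LinearMap.congr_fun hg (s x)
  simp only [LinearMap.comp_apply] at this
  simp [this, hrs]

/-- Vanishing of `Ext¹(-, D)` on an internal direct sum. -/
theorem of_isInternal {ι : Type u} [DecidableEq ι] (N : ι → Submodule R M)
    (hN : DirectSum.IsInternal N) (h : ∀ i, Ext1Vanish R (N i) D) : Ext1Vanish R M D := by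
  intro E _ _ i p hi hp hip
  choose g hg using fun k => (h k).exists_lift i p hi hp hip (N k).subtype
  let e := LinearEquiv.ofBijective (DirectSum.coeLinearMap N) hN
  refine ⟨DirectSum.toModule R ι E g ∘ₗ e.symm.toLinearMap, ?_⟩
  have : p ∘ₗ DirectSum.toModule R ι E g = e.toLinearMap := by
    refine DirectSum.linearMap_ext R fun k => LinearMap.ext fun x => ?_
    simp only [LinearMap.comp_apply, DirectSum.toModule_lof, LinearEquiv.coe_coe]
    have h1 := LinearMap.congr_fun (hg k) x
    simp only [LinearMap.comp_apply] at h1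
    rw [h1]
    exact (DirectSum.coeLinearMap_lof N k x).symm
  rw [← LinearMap.comp_assoc, this]
  ext x
  simp

theorem finsupp (h : Ext1Vanish R M D) (ι : Type u) : Ext1Vanish R (ι →₀ M) D := by
  classical
  intro E _ _ i p hi hp hip
  choose g hg using fun k => h.exists_lift i p hi hp hip (Finsupp.lsingle k : M →ₗ[R] ι →₀ M)
  refine ⟨Finsupp.lsum R g, Finsupp.lhom_ext' fun k => LinearMap.ext fun x => ?_⟩
  have h1 := LinearMap.congr_fun (hg k) x
  simpa using h1

theorem prod (h : Ext1Vanish R M D) {M' : Type u} [AddCommGroup M'] [Module R M']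
    (h' : Ext1Vanish R M' D) : Ext1Vanish R (M × M') D := by
  intro E _ _ i p hi hp hip
  obtain ⟨g, hg⟩ := h.exists_lift i p hi hp hip (LinearMap.inl R M M')
  obtain ⟨g', hg'⟩ := h'.exists_lift i p hi hp hip (LinearMap.inr R M M')
  refine ⟨LinearMap.coprod g g', ?_⟩
  rw [LinearMap.comp_coprod, hg, hg', LinearMap.coprod_inl_inr]

/-- Extension step: `A ≤ B` with `B/A` isomorphic, through `q`, to a module `C` with
`Ext¹(C, D) = 0`. -/
theorem exists_extension_submodule {F : Type u} [AddCommGroup F] [Module R F] {A B : Submodule R F}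
    (hAB : A ≤ B) (h : Ext1Vanish R M D) (q : B →ₗ[R] M) (hq : Function.Surjective q)
    (hker : ∀ x : B, q x = 0 ↔ (x : F) ∈ A) (f : A →ₗ[R] D) :
    ∃ g : B →ₗ[R] D, ∀ x (hx : x ∈ A), g ⟨x, hAB hx⟩ = f ⟨x, hx⟩ := by
  obtain ⟨g, hg⟩ := h.exists_extension (Submodule.inclusion hAB) q
    (Submodule.inclusion_injective hAB) hq (by
      ext x
      rw [LinearMap.mem_ker, hker, Submodule.range_inclusion]
      rfl) f
  exact ⟨g, fun x hx => LinearMap.congr_fun hg ⟨x, hx⟩⟩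

/-- Vanishing of `Ext¹(-, D)` is closed under extensions. -/
theorem of_extension {M'' : Type u} [AddCommGroup M''] [Module R M''] (q : M →ₗ[R] M'')
    (hq : Function.Surjective q) (h' : Ext1Vanish R (LinearMap.ker q) D)
    (h'' : Ext1Vanish R M'' D) : Ext1Vanish R M D := by
  let π : (M →₀ R) →ₗ[R] M := Finsupp.linearCombination R id
  have hπ : Function.Surjective π := Finsupp.linearCombination_id_surjective R M
  refine of_forall_extension of_projective π hπ fun f => ?_
  have hle : LinearMap.ker π ≤ LinearMap.ker (q ∘ₗ π) := LinearMap.ker_le_ker_comp π q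
  obtain ⟨B, hBdef⟩ : ∃ B, B = LinearMap.ker (q ∘ₗ π) := ⟨_, rfl⟩
  rw [← hBdef] at hle
  have hmem : ∀ x, x ∈ B ↔ q (π x) = 0 := fun x => by rw [hBdef]; rfl
  have hB : ∀ x : B, (π ∘ₗ B.subtype) x ∈ LinearMap.ker q := fun x => (hmem _).1 x.2
  have hBr : LinearMap.range B.subtype = LinearMap.ker (q ∘ₗ π) := by
    rw [Submodule.range_subtype, hBdef]
  let t : B →ₗ[R] LinearMap.ker q := LinearMap.codRestrict _ (π ∘ₗ B.subtype) hB
  have ht : Function.Surjective t := by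
    rintro ⟨m, hm⟩
    obtain ⟨x, rfl⟩ := hπ m
    exact ⟨⟨x, (hmem x).2 hm⟩, rfl⟩
  have htk : ∀ x : B, t x = 0 ↔ (x : M →₀ R) ∈ LinearMap.ker π := fun x => by
    rw [Subtype.ext_iff, LinearMap.mem_ker]; rfl
  obtain ⟨g, hg⟩ := h'.exists_extension_submodule (A := LinearMap.ker π) (B := B) hle t ht htk f
  obtain ⟨g', hg'⟩ := h''.exists_extension (N := B) (X := M →₀ R) B.subtype (q ∘ₗ π)
    (Submodule.subtype_injective _) (hq.comp hπ) hBr g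
  refine ⟨g', fun x => ?_⟩
  have h1 : g' x = g ⟨x, hle x.2⟩ := LinearMap.congr_fun hg' ⟨x, hle x.2⟩
  rw [h1, hg x x.2]

end Ext1Vanish

/-- A linear map on the first member of an exhaustive chain of submodules extends to the whole
module if extensions exist at every step. -/
theorem exists_extension_of_chain {R F D : Type*} [CommRing R] [AddCommGroup F] [Module R F]
    [AddCommGroup D] [Module R D] (N : ℕ → Submodule R F) (hmono : Monotone N)
    (hsup : ∀ x, ∃ n, x ∈ N n)
    (step : ∀ n (f : N n →ₗ[R] D), ∃ g : N (n + 1) →ₗ[R] D,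
      ∀ x (hx : x ∈ N n), g ⟨x, hmono n.le_succ hx⟩ = f ⟨x, hx⟩)
    (f : N 0 →ₗ[R] D) : ∃ g : F →ₗ[R] D, ∀ x : N 0, g x = f x := by
  choose next hnext using step
  let φ : ∀ n, N n →ₗ[R] D := fun n => Nat.rec f (fun n g => next n g) n
  have hφ : ∀ n m (h : n ≤ m) x (hx : x ∈ N n), φ m ⟨x, hmono h hx⟩ = φ n ⟨x, hx⟩ := by
    intro n m h x hx
    induction m, h using Nat.le_induction with
    | base => rfl
    | succ m h ih => rw [← ih]; exact hnext m (φ m) x (hmono h hx)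
  choose k hk using hsup
  have hval : ∀ n x (hx : x ∈ N n), φ (k x) ⟨x, hk x⟩ = φ n ⟨x, hx⟩ := by
    intro n x hx
    rw [← hφ n (max n (k x)) (le_max_left _ _) x hx,
      ← hφ (k x) (max n (k x)) (le_max_right _ _) x (hk x)]
  refine ⟨{ toFun := fun x => φ (k x) ⟨x, hk x⟩, map_add' := fun x y => ?_,
            map_smul' := fun r x => ?_ }, fun x => hval 0 x x.2⟩
  · have hx := hmono (le_max_left (k x) (k y)) (hk x)
    have hy := hmono (le_max_right (k x) (k y)) (hk y)
    rw [hval _ x hx, hval _ y hy, hval _ (x + y) (add_mem hx hy), ← map_add]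
    rfl
  · rw [hval (k x) (r • x) (Submodule.smul_mem _ r (hk x))]
    exact map_smul (φ (k x)) r ⟨x, hk x⟩

/-- The module `M` is divisible by every element of `S`. -/
def IsDivisibleBy {R : Type*} [CommRing R] (S : Submonoid R) (M : Type*) [AddCommGroup M]
    [Module R M] : Prop :=
  ∀ s ∈ S, ∀ x : M, ∃ y : M, s • y = x

/-- The elements of `M` whose annihilator is contained in no maximal ideal other than `m`. -/
def localComponent {R : Type*} [CommRing R] (M : Type*) [AddCommGroup M] [Module R M]
    (m : Ideal R) : Submodule R M where
  carrier := {x | ∀ n : Ideal R, n.IsMaximal → Ideal.torsionOf R M x ≤ n → n = m}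
  add_mem' {x y} hx hy n hn hle := by
    have h : Ideal.torsionOf R M x * Ideal.torsionOf R M y ≤ n := by
      refine (Ideal.mul_le_inf.trans fun r hr => ?_).trans hle
      have h1 := (Ideal.mem_torsionOf_iff x r).1 hr.1
      have h2 := (Ideal.mem_torsionOf_iff y r).1 hr.2
      rw [Ideal.mem_torsionOf_iff, smul_add, h1, h2, add_zero]
    rcases hn.isPrime.mul_le.1 h with h | h
    exacts [hx n hn h, hy n hn h]
  zero_mem' n hn hle := by
    rw [Ideal.torsionOf_zero, top_le_iff] at hle
    exact absurd hle hn.ne_top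
  smul_mem' r x hx n hn hle := by
    refine hx n hn (le_trans (fun a ha => ?_) hle)
    rw [Ideal.mem_torsionOf_iff] at ha ⊢
    rw [smul_comm, ha, smul_zero]

section

variable {R : Type u} [CommRing R] {M : Type u} [AddCommGroup M] [Module R M]

theorem mem_localComponent {m : Ideal R} {x : M} : x ∈ localComponent M m ↔
    ∀ n : Ideal R, n.IsMaximal → Ideal.torsionOf R M x ≤ n → n = m :=
  Iff.rfl

theorem iSupIndep_localComponent :
    iSupIndep fun m : {m : Ideal R // m.IsMaximal} => localComponent M m.1 := by
  intro m
  have hm := m.2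
  let K : Submodule R M :=
    { carrier := {y | ∃ r ∉ m.1, r • y = 0}
      add_mem' := by
        rintro x y ⟨r, hr, hrx⟩ ⟨t, ht, hty⟩
        refine ⟨r * t, fun h => (hm.isPrime.mem_or_mem h).elim hr ht, ?_⟩
        rw [smul_add, mul_smul, mul_smul, hty, smul_comm r t x, hrx, smul_zero, smul_zero, add_zero]
      zero_mem' := ⟨1, fun h => hm.ne_top ((Ideal.eq_top_iff_one _).2 h), smul_zero _⟩
      smul_mem' := by
        rintro a x ⟨r, hr, hrx⟩
        exact ⟨r, hr, by rw [smul_comm, hrx, smul_zero]⟩ }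
  have hK : ⨆ j, ⨆ _ : j ≠ m, localComponent M j.1 ≤ K := by
    refine iSup₂_le fun j hj x hx => ?_
    have hnot : ¬ Ideal.torsionOf R M x ≤ m.1 := fun hle => hj (Subtype.ext (hx m.1 hm hle).symm)
    obtain ⟨r, hr, hrm⟩ := SetLike.not_le_iff_exists.1 hnot
    exact ⟨r, hrm, (Ideal.mem_torsionOf_iff x r).1 hr⟩
  refine Disjoint.mono_right hK (Submodule.disjoint_def.2 ?_)
  rintro x hx ⟨r, hr, hrx⟩
  have htop : Ideal.torsionOf R M x = ⊤ := by
    by_contra hne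
    obtain ⟨n, hn, hle⟩ := Ideal.exists_le_maximal _ hne
    have := hx n hn hle
    subst this
    exact hr (hle ((Ideal.mem_torsionOf_iff x r).2 hrx))
  exact (Ideal.torsionOf_eq_top_iff (R := R) x).1 htop

theorem iSup_localComponent (h : ∀ x : M, HasMinimalModulo (Ideal.torsionOf R M x)) :
    ⨆ m : {m : Ideal R // m.IsMaximal}, localComponent M m.1 = ⊤ := by
  refine top_le_iff.1 fun x _ => ?_
  obtain ⟨F, hF, htop⟩ := (h x).exists_isolating
  have hfx : ∀ f ∈ F, f • x ∈ ⨆ m : {m : Ideal R // m.IsMaximal}, localComponent M m.1 := by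
    intro f hf
    obtain ⟨hff, m, hm, hle, hfm, hu⟩ := hF f hf
    refine Submodule.mem_iSup_of_mem ⟨m, hm⟩ (mem_localComponent.2 fun n hn hnle => ?_)
    have h1 : 1 - f ∈ n := hnle (by
      rw [Ideal.mem_torsionOf_iff] at hff ⊢
      rw [← mul_smul, ← neg_eq_zero, ← neg_smul, ← hff]
      congr 1
      ring)
    refine hu n hn (le_trans (fun a ha => ?_) hnle) fun hfn => hn.ne_top
      ((Ideal.eq_top_iff_one n).2 (by simpa using n.add_mem h1 hfn))
    rw [Ideal.mem_torsionOf_iff] at ha ⊢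
    rw [smul_comm, ha, smul_zero]
  rw [Ideal.eq_top_iff_one, Submodule.mem_sup] at htop
  obtain ⟨i, hi, z, hz, hiz⟩ := htop
  have hx : x = z • x := by
    have h1 := (Ideal.mem_torsionOf_iff x i).1 hi
    have h2 : (i + z) • x = x := by rw [hiz, one_smul]
    rwa [add_smul, h1, zero_add, eq_comm] at h2
  rw [hx]
  clear hx hiz
  induction hz using Submodule.span_induction with
  | mem f hf => exact hfx f hf
  | zero => simp
  | add a b _ _ ha hb => rw [add_smul]; exact add_mem ha hb
  | smul a b _ hb => rw [smul_eq_mul, mul_smul]; exact Submodule.smul_mem _ a hb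

end

namespace Ext1Vanish

variable {R : Type u} [CommRing R] {C D : Type u} [AddCommGroup C] [Module R C]
  [AddCommGroup D] [Module R D]

/-- `Ext¹(-, D)` vanishes on an `s`-power torsion `s`-divisible module as soon as it vanishes on the
submodule of elements killed by `s`. -/
theorem of_powerTorsion (s : R) (htors : ∀ x : C, ∃ n : ℕ, s ^ n • x = 0)
    (hdiv : ∀ x : C, ∃ y, s • y = x) (h : Ext1Vanish R (Submodule.torsionBy R C s) D) :
    Ext1Vanish R C D := by
  let π : (C →₀ R) →ₗ[R] C := Finsupp.linearCombination R id
  have hπ : Function.Surjective π := Finsupp.linearCombination_id_surjective R C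
  have hdiv' : ∀ (n : ℕ) (x : C), ∃ y, s ^ n • y = x := by
    intro n
    induction n with
    | zero => exact fun x => ⟨x, by simp⟩
    | succ n ih =>
      intro x
      obtain ⟨y, rfl⟩ := hdiv x
      obtain ⟨z, rfl⟩ := ih y
      exact ⟨z, by rw [pow_succ', mul_smul]⟩
  obtain ⟨N, hN⟩ : ∃ N : ℕ → Submodule R (C →₀ R), ∀ n x, x ∈ N n ↔ s ^ n • π x = 0 :=
    ⟨fun n => LinearMap.ker (s ^ n • π), fun n x => Iff.rfl⟩
  have hmono : Monotone N := by
    intro a b hab x hx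
    rw [hN] at hx ⊢
    obtain ⟨c, rfl⟩ := Nat.exists_eq_add_of_le hab
    rw [add_comm, pow_add, mul_smul, hx, smul_zero]
  refine of_forall_extension of_projective π hπ fun f => ?_
  have h0 : LinearMap.ker π = N 0 := by
    ext x
    rw [hN, pow_zero, one_smul]
    rfl
  have hsup : ∀ x, ∃ n, x ∈ N n := fun x => by
    obtain ⟨n, hn⟩ := htors (π x)
    exact ⟨n, (hN n x).2 hn⟩
  have step : ∀ n (f : N n →ₗ[R] D), ∃ g : N (n + 1) →ₗ[R] D,
      ∀ x (hx : x ∈ N n), g ⟨x, hmono n.le_succ hx⟩ = f ⟨x, hx⟩ := fun n f => by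
    have hq : ∀ x : N (n + 1), ((s ^ n • π) ∘ₗ (N (n + 1)).subtype) x ∈
        Submodule.torsionBy R C s := fun x => by
      have h1 := (hN (n + 1) x).1 x.2
      rw [Submodule.mem_torsionBy_iff]
      rw [pow_succ', mul_smul] at h1
      exact h1
    refine h.exists_extension_submodule (hmono n.le_succ) (LinearMap.codRestrict _ _ hq) ?_ ?_ f
    · rintro ⟨c, hc⟩
      obtain ⟨d, rfl⟩ := hdiv' n c
      obtain ⟨x, rfl⟩ := hπ d
      refine ⟨⟨x, (hN _ _).2 ?_⟩, rfl⟩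
      rw [pow_succ', mul_smul]
      exact hc
    · intro x
      rw [hN, Subtype.ext_iff]
      rfl
  obtain ⟨g, hg⟩ := exists_extension_of_chain N hmono hsup step (f ∘ₗ Submodule.inclusion h0.ge)
  exact ⟨g, fun x => hg ⟨x, h0 ▸ x.2⟩⟩

theorem of_torsion (S : Submonoid R) (hS : ∀ s ∈ S, ∀ J : Ideal R, s ∈ J → HasMinimalModulo J)
    (htors : ∀ x : C, ∃ s ∈ S, s • x = 0) (hdiv : IsDivisibleBy S C)
    (h : ∀ s ∈ S, Ext1Vanish R (Submodule.torsionBy R C s) D) : Ext1Vanish R C D := by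
  classical
  have hmin : ∀ x : C, HasMinimalModulo (Ideal.torsionOf R C x) := fun x => by
    obtain ⟨s, hs, hsx⟩ := htors x
    exact hS s hs _ hsx
  have hind := iSupIndep_localComponent (R := R) (M := C)
  have hsup := iSup_localComponent hmin
  refine of_isInternal _
    (DirectSum.isInternal_submodule_of_iSupIndep_of_iSup_eq_top hind hsup) fun m => ?_
  by_cases hbot : ∀ x ∈ localComponent C m.1, x = 0
  · have : Subsingleton (localComponent C m.1) :=
      ⟨fun a b => Subtype.ext ((hbot a a.2).trans (hbot b b.2).symm)⟩
    exact of_projective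
  push Not at hbot
  obtain ⟨x₀, hx₀, hne⟩ := hbot
  obtain ⟨s, hs, hsx⟩ := htors x₀
  have hle : ∀ x ∈ localComponent C m.1, x ≠ 0 → Ideal.torsionOf R C x ≤ m.1 := by
    intro x hx hne
    obtain ⟨n, hn, hle⟩ := Ideal.exists_le_maximal (Ideal.torsionOf R C x)
      fun h => hne ((Ideal.torsionOf_eq_top_iff (R := R) x).1 h)
    rwa [← hx n hn hle]
  have hsm : s ∈ m.1 := hle x₀ hx₀ hne hsx
  have hc : IsCompl (localComponent C m.1)
      (⨆ j : {m : Ideal R // m.IsMaximal}, ⨆ _ : j ≠ m, localComponent C j.1) := by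
    refine ⟨hind m, codisjoint_iff.2 (top_le_iff.1 (hsup ▸ iSup_le fun j => ?_))⟩
    by_cases hj : j = m
    · exact hj ▸ le_sup_left
    · exact le_sup_of_le_right (le_iSup₂_of_le j hj le_rfl)
  let r : C →ₗ[R] localComponent C m.1 := Submodule.projectionOnto _ _ hc
  have hr : ∀ x : localComponent C m.1, r x = x := Submodule.projectionOnto_apply_left hc
  refine of_powerTorsion s ?_ ?_ ?_
  · rintro ⟨x, hx⟩
    obtain ⟨_, ⟨n, rfl⟩, hn⟩ := hmin x {y | ∃ n : ℕ, s ^ n = y} ⟨1, 0, pow_zero s⟩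
    refine ⟨n, Subtype.ext ?_⟩
    obtain ⟨c, hc⟩ := hn s ⟨n + 1, pow_succ s n⟩
    by_contra hne
    have h1 := hle (s ^ n • x) (Submodule.smul_mem _ _ hx) hne
    have h2 : 1 - s * c ∈ m.1 := h1 (by
      rw [Ideal.mem_torsionOf_iff] at hc ⊢
      rw [← mul_smul, ← hc]
      congr 1
      ring)
    exact m.2.ne_top ((Ideal.eq_top_iff_one _).2 (by
      simpa using m.1.add_mem h2 (m.1.mul_mem_right c hsm)))
  · intro x
    obtain ⟨y, hy⟩ := hdiv s hs x
    exact ⟨r y, by rw [← map_smul, hy, hr]⟩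
  · refine (h s hs).of_retract
      (LinearMap.codRestrict _ ((localComponent C m.1).subtype ∘ₗ
        (Submodule.torsionBy R (localComponent C m.1) s).subtype) fun x => ?_)
      (LinearMap.codRestrict _ (r ∘ₗ (Submodule.torsionBy R C s).subtype) fun x => ?_)
      fun x => Subtype.ext (hr x)
    · have := x.2
      rw [Submodule.mem_torsionBy_iff] at this ⊢
      exact congrArg Subtype.val this
    · rw [Submodule.mem_torsionBy_iff, ← map_smul]
      simp

end Ext1Vanish

section

variable {R : Type u} [CommRing R]

/-- The map induced on the elements killed by `s`, as a map of `R ⧸ (s)`-modules. -/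
def torsionByMap (s : R) {B C : Type*} [AddCommGroup B] [Module R B] [AddCommGroup C] [Module R C]
    (g : B →ₗ[R] C) :
    Submodule.torsionBy R B s →ₗ[R ⧸ Ideal.span {s}] Submodule.torsionBy R C s where
  toFun x := ⟨g x, by
    rw [Submodule.mem_torsionBy_iff, ← map_smul, (Submodule.mem_torsionBy_iff s _).1 x.2, map_zero]⟩
  map_add' x y := Subtype.ext (map_add g _ _)
  map_smul' r x := by
    obtain ⟨r, rfl⟩ := Ideal.Quotient.mk_surjective r
    exact Subtype.ext (map_smul g r x.1)

theorem flat_torsionBy_of_lift_relations (s : R) {C : Type*} [AddCommGroup C] [Module R C]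
    (h : ∀ (l : ℕ) (r : Fin l → R) (y : Fin l → C), (∀ k, s • y k = 0) → ∑ k, r k • y k = 0 →
      ∃ (B : Type u) (_ : AddCommGroup B) (_ : Module R B)
        (_ : Module.Flat (R ⧸ Ideal.span {s}) (Submodule.torsionBy R B s))
        (g : B →ₗ[R] C) (y' : Fin l → B), (∀ k, s • y' k = 0) ∧ (∀ k, g (y' k) = y k) ∧
          ∑ k, r k • y' k = 0) :
    Module.Flat (R ⧸ Ideal.span {s}) (Submodule.torsionBy R C s) := by
  refine flat_of_lift_relations.{u} fun l r y hry => ?_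
  choose r' hr' using fun k => Ideal.Quotient.mk_surjective (r k)
  obtain rfl : (fun k => Ideal.Quotient.mk _ (r' k)) = r := funext hr'
  obtain ⟨B, _, _, hB, g, y', hsy, hgy, hr⟩ := h l r' (fun k => y k) (fun k => (y k).2) (by
    have := congrArg Subtype.val hry
    simpa using this)
  refine ⟨Submodule.torsionBy R B s, inferInstance, inferInstance, hB, torsionByMap s g,
    fun k => ⟨y' k, hsy k⟩, fun k => Subtype.ext (hgy k), Subtype.ext ?_⟩
  simpa using hr

theorem flat_torsionBy_of_retract (s : R) {B C : Type u} [AddCommGroup B] [Module R B]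
    [AddCommGroup C] [Module R C] [Module.Flat (R ⧸ Ideal.span {s}) (Submodule.torsionBy R B s)]
    (i : C →ₗ[R] B) (p : B →ₗ[R] C) (hpi : ∀ x, p (i x) = x) :
    Module.Flat (R ⧸ Ideal.span {s}) (Submodule.torsionBy R C s) :=
  Module.Flat.of_retract (torsionByMap s i) (torsionByMap s p)
    (LinearMap.ext fun x => Subtype.ext (hpi x))

open Submodule in
theorem flat_torsionBy_of_surjective {Q : Type*} [CommRing Q] [Algebra R Q] {s : R}
    (hs : IsUnit (algebraMap R Q s)) {V C : Type u} [AddCommGroup V] [Module R V] [Module Q V]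
    [IsScalarTower R Q V] [AddCommGroup C] [Module R C] (π : V →ₗ[R] C)
    (hπ : Function.Surjective π) [Module.Flat R (LinearMap.ker π)] :
    Module.Flat (R ⧸ Ideal.span {s}) (Submodule.torsionBy R C s) := by
  obtain ⟨q, hq⟩ := hs.exists_left_inv
  have hqv : ∀ v : V, q • s • v = v := fun v => by
    rw [← algebraMap_smul Q s v, ← mul_smul, hq, one_smul]
  have hqv' : ∀ v : V, s • q • v = v := fun v => by
    rw [smul_comm, hqv]
  let h : LinearMap.ker π →ₗ[R] torsionBy R C s :=
    { toFun := fun n => ⟨π (q • n), by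
        rw [mem_torsionBy_iff, ← map_smul, hqv']; exact n.2⟩
      map_add' := fun a b => Subtype.ext (by simp)
      map_smul' := fun r a => Subtype.ext (by simp [smul_comm q r]) }
  refine flat_of_lift_relations.{u} fun l r y hry => ?_
  choose r' hr' using fun k => Ideal.Quotient.mk_surjective (r k)
  obtain rfl : (fun k => Ideal.Quotient.mk _ (r' k)) = r := funext hr'
  choose v hv using fun k => hπ (y k)
  have hw : π (∑ k, r' k • v k) = 0 := by
    have := congrArg Subtype.val hry
    simpa [hv] using this
  have hn : ∀ k, π (s • v k) = 0 := fun k => by rw [map_smul, hv]; exact (y k).2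
  have hst : IsScalarTower R (R ⧸ Ideal.span {s}) (torsionBy R C s) :=
    inferInstanceAs (IsScalarTower R (R ⧸ R ∙ s) (torsionBy R C s))
  refine ⟨(R ⧸ Ideal.span {s}) ⊗[R] LinearMap.ker π, inferInstance, inferInstance, inferInstance,
    LinearMap.liftBaseChange _ h, fun k => 1 ⊗ₜ ⟨s • v k, hn k⟩, fun k => Subtype.ext ?_, ?_⟩
  · simp [h, hqv, hv]
  · have h1 : ∀ k, Ideal.Quotient.mk (Ideal.span {s}) (r' k) •
        ((1 : R ⧸ Ideal.span {s}) ⊗ₜ[R] (⟨s • v k, hn k⟩ : LinearMap.ker π)) =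
        (1 : R ⧸ Ideal.span {s}) ⊗ₜ[R] (r' k • (⟨s • v k, hn k⟩ : LinearMap.ker π)) := fun k => by
      rw [TensorProduct.tmul_smul]; rfl
    rw [Finset.sum_congr rfl fun k _ => h1 k, ← TensorProduct.tmul_sum]
    have h2 : ∑ k, r' k • (⟨s • v k, hn k⟩ : LinearMap.ker π) = s • ⟨_, hw⟩ := Subtype.ext (by
      simp [Finset.smul_sum, smul_comm s])
    rw [h2, ← TensorProduct.smul_tmul]
    have h3 : s • (1 : R ⧸ Ideal.span {s}) = 0 := by
      rw [← map_one (Ideal.Quotient.mk _), ← Ideal.Quotient.mk_eq_mk, ← Submodule.Quotient.mk_smul]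
      exact Ideal.Quotient.eq_zero_iff_mem.2 (by simp)
    rw [h3, TensorProduct.zero_tmul]

theorem Ext1Vanish.torsionBy_of_flat {s : R} (hs : IsPerfectRing (R ⧸ Ideal.span {s}))
    {C D : Type u} [AddCommGroup C] [Module R C] [AddCommGroup D] [Module R D]
    (hC : Module.Flat (R ⧸ Ideal.span {s}) (Submodule.torsionBy R C s))
    (hD : ∀ x : D, ∃ y, s • y = x) : Ext1Vanish R (Submodule.torsionBy R C s) D := by
  have hproj := hs _ hC
  intro E _ _ i p hi hp hip
  have hpi : ∀ d, p (i d) = 0 := fun d => by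
    have : i d ∈ LinearMap.ker p := hip ▸ LinearMap.mem_range_self i d
    exact this
  let p' : Submodule.torsionBy R E s →ₗ[R ⧸ Ideal.span {s}] Submodule.torsionBy R C s :=
    { toFun := fun e => p e
      map_add' := fun a b => map_add p _ _
      map_smul' := fun r x => by
        obtain ⟨r, rfl⟩ := Ideal.Quotient.mk_surjective r
        exact map_smul p r x.1 }
  have hp' : Function.Surjective p' := fun x => by
    obtain ⟨e, rfl⟩ := hp x
    have : s • e ∈ LinearMap.range i := by
      rw [hip, LinearMap.mem_ker, map_smul]
      exact Subtype.ext (p e).2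
    obtain ⟨d, hd⟩ := this
    obtain ⟨d', rfl⟩ := hD d
    refine ⟨⟨e - i d', ?_⟩, ?_⟩
    · rw [Submodule.mem_torsionBy_iff, smul_sub, ← map_smul, hd, sub_self]
    · simp [p', hpi]
  obtain ⟨t, ht⟩ := Module.projective_lifting_property p' LinearMap.id hp'
  refine ⟨{ toFun := fun x => t x
            map_add' := fun a b => by simp
            map_smul' := fun r a => ?_ }, LinearMap.ext fun x => LinearMap.congr_fun ht x⟩
  exact congrArg Subtype.val (map_smul t (Ideal.Quotient.mk _ r) a)

end

section

variable {R : Type u} [CommRing R] {S : Submonoid R} {Q : Type u} [CommRing Q] [Algebra R Q]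
  [IsLocalization S Q]

variable (S Q) in
/-- Flatness of a localized module can be tested by lifting the relations of the module, up to
denominators. -/
theorem flat_baseChange_of_lift_relations {C : Type u} [AddCommGroup C] [Module R C]
    (h : ∀ (l : ℕ) (r : Fin l → R) (c : Fin l → C), ∑ k, r k • c k = 0 →
      ∃ (B : Type u) (_ : AddCommGroup B) (_ : Module R B) (_ : Module.Flat Q (Q ⊗[R] B))
        (g : B →ₗ[R] C) (u t : R) (_ : u ∈ S) (_ : t ∈ S) (b : Fin l → B),
          (∀ k, g (b k) = u • c k) ∧ t • ∑ k, r k • b k = 0) :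
    Module.Flat Q (Q ⊗[R] C) := by
  refine flat_of_lift_relations.{u} fun l q z hqz => ?_
  obtain ⟨s, hs⟩ := IsLocalization.exist_integer_multiples_of_finite S q
  obtain ⟨t, ht⟩ := IsLocalizedModule.exist_integer_multiples_of_finite S
    (TensorProduct.mk R Q C 1) z
  choose r hr using hs
  choose c hc using ht
  have hc : ∀ k, (1 : Q) ⊗ₜ[R] c k = t.1 • z k := hc
  have hr : ∀ k, algebraMap R Q (r k) = s.1 • q k := hr
  have h1 : TensorProduct.mk R Q C 1 (∑ k, r k • c k) = 0 := by
    have h2 : ∀ k, (1 : Q) ⊗ₜ[R] (r k • c k) = s.1 • t.1 • q k • z k := fun k => by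
      rw [TensorProduct.tmul_smul, hc, ← algebraMap_smul Q (r k), hr, smul_comm, smul_assoc,
        smul_comm t.1 s.1]
    rw [map_sum]
    simp only [TensorProduct.mk_apply, h2]
    rw [← Finset.smul_sum, ← Finset.smul_sum, hqz, smul_zero, smul_zero]
  obtain ⟨w, hw⟩ := (IsLocalizedModule.eq_zero_iff S (TensorProduct.mk R Q C 1)).1 h1
  have hw' : ∑ k, (w.1 * r k) • c k = 0 := by
    rw [← hw, Submonoid.smul_def, Finset.smul_sum]
    simp only [mul_smul]
  obtain ⟨B, _, _, hB, g, u, t', hu, ht', b, hgb, hb⟩ := h l _ c hw'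
  have hunit : ∀ a ∈ S, IsUnit (algebraMap R Q a) := fun a ha => IsLocalization.map_units Q ⟨a, ha⟩
  obtain ⟨d, hd⟩ := (hunit _ (mul_mem hu t.2)).exists_left_inv
  refine ⟨Q ⊗[R] B, inferInstance, inferInstance, hB, g.baseChange Q, fun k => d • 1 ⊗ₜ b k,
    fun k => ?_, ?_⟩
  · rw [map_smul, LinearMap.baseChange_tmul, hgb, TensorProduct.tmul_smul, hc, ← mul_smul,
      ← algebraMap_smul Q (u * t.1), ← mul_smul, hd, one_smul]
  · have hcancel : ∀ a ∈ S, ∀ x : Q ⊗[R] B, a • x = 0 → x = 0 := fun a ha x hx => by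
      rw [← algebraMap_smul Q] at hx
      exact (hunit a ha).smul_eq_zero.1 hx
    refine hcancel _ (mul_mem (mul_mem ht' w.2) s.2) _ ?_
    have h3 : ∀ k, (t' * w.1 * s.1) • q k • d • (1 : Q) ⊗ₜ[R] b k =
        d • (1 : Q) ⊗ₜ[R] (t' • (w.1 * r k) • b k) := fun k => by
      rw [TensorProduct.tmul_smul, TensorProduct.tmul_smul, smul_comm (q k) d, smul_comm _ d,
        mul_smul, mul_smul, mul_smul, ← smul_assoc s.1 (q k), ← hr, algebraMap_smul]
    rw [Finset.smul_sum, Finset.sum_congr rfl fun k _ => h3 k, ← Finset.smul_sum,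
      ← TensorProduct.tmul_sum, ← Finset.smul_sum, hb, TensorProduct.tmul_zero, smul_zero]

theorem Ext1Vanish.of_flat_baseChange (hQ : IsPerfectRing Q)
    (hS : ∀ s ∈ S, ∀ J : Ideal R, s ∈ J → IsPerfectRing (R ⧸ J)) {C D : Type u} [AddCommGroup C]
    [Module R C] [AddCommGroup D] [Module R D] (hQD : Ext1Vanish R Q D) (hC : IsDivisibleBy S C)
    (hD : IsDivisibleBy S D)
    (hflat : ∀ s ∈ S, Module.Flat (R ⧸ Ideal.span {s}) (Submodule.torsionBy R C s))
    (hflatQ : Module.Flat Q (Q ⊗[R] C)) : Ext1Vanish R C D := by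
  have hproj := hQ _ hflatQ
  let q : C →ₗ[R] Q ⊗[R] C := TensorProduct.mk R Q C 1
  have hker : ∀ x, q x = 0 ↔ ∃ s : S, s • x = 0 := fun x =>
    IsLocalizedModule.eq_zero_iff S (TensorProduct.mk R Q C 1)
  have hqs : Function.Surjective q := fun z => by
    obtain ⟨⟨c, s⟩, hc⟩ := IsLocalizedModule.surj S q z
    obtain ⟨d, rfl⟩ := hC s s.2 c
    refine ⟨d, ?_⟩
    have h1 : algebraMap R Q s.1 • q d = algebraMap R Q s.1 • z := by
      rw [algebraMap_smul, algebraMap_smul, ← map_smul]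
      exact hc.symm
    exact (IsLocalization.map_units Q s).smul_left_cancel.1 h1
  refine of_extension q hqs ?_ ?_
  · refine of_torsion S (fun s hs J hJ => (hS s hs J hJ).hasMinimalModulo) ?_ ?_ ?_
    · rintro ⟨x, hx⟩
      obtain ⟨s, hs⟩ := (hker x).1 hx
      exact ⟨s, s.2, Subtype.ext hs⟩
    · rintro s hs ⟨x, hx⟩
      obtain ⟨t, ht⟩ := (hker x).1 hx
      obtain ⟨y, rfl⟩ := hC s hs x
      exact ⟨⟨y, (hker y).2 ⟨t * ⟨s, hs⟩, by rw [mul_smul]; exact ht⟩⟩, rfl⟩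
    · intro s hs
      refine (torsionBy_of_flat (hS s hs _ (Ideal.mem_span_singleton_self s)) (hflat s hs)
        (hD s hs)).of_retract
        (LinearMap.codRestrict _ ((LinearMap.ker q).subtype ∘ₗ Submodule.subtype _) fun x =>
          congrArg Subtype.val x.2)
        (LinearMap.codRestrict _ (LinearMap.codRestrict (LinearMap.ker q) (Submodule.subtype _)
          fun x => (hker _).2 ⟨⟨s, hs⟩, x.2⟩) fun x => Subtype.ext x.2) fun x => rfl
  · obtain ⟨i, hi⟩ := Module.projective_lifting_property
      (Finsupp.linearCombination Q (id : Q ⊗[R] C → Q ⊗[R] C)) LinearMap.id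
      (Finsupp.linearCombination_id_surjective Q _)
    exact (hQD.finsupp (Q ⊗[R] C)).of_retract (i.restrictScalars R)
      ((Finsupp.linearCombination Q (id : Q ⊗[R] C → Q ⊗[R] C)).restrictScalars R)
      fun x => LinearMap.congr_fun hi x

end

namespace IsDivisibleBy

variable {R : Type*} [CommRing R] {S : Submonoid R} {M N : Type*} [AddCommGroup M] [Module R M]
  [AddCommGroup N] [Module R N]

theorem of_surjective (h : IsDivisibleBy S M) (f : M →ₗ[R] N) (hf : Function.Surjective f) :
    IsDivisibleBy S N := by
  intro s hs x
  obtain ⟨x, rfl⟩ := hf x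
  obtain ⟨y, rfl⟩ := h s hs x
  exact ⟨f y, (map_smul f s y).symm⟩

theorem prod (h : IsDivisibleBy S M) (h' : IsDivisibleBy S N) : IsDivisibleBy S (M × N) := by
  rintro s hs ⟨x, y⟩
  obtain ⟨x, rfl⟩ := h s hs x
  obtain ⟨y, rfl⟩ := h' s hs y
  exact ⟨(x, y), rfl⟩

theorem finsupp (h : IsDivisibleBy S M) (ι : Type*) : IsDivisibleBy S (ι →₀ M) := by
  intro s hs x
  induction x using Finsupp.induction_linear with
  | zero => exact ⟨0, smul_zero s⟩
  | add a b ha hb =>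
    obtain ⟨a, rfl⟩ := ha
    obtain ⟨b, rfl⟩ := hb
    exact ⟨a + b, smul_add s a b⟩
  | single i a =>
    obtain ⟨a, rfl⟩ := h s hs a
    exact ⟨Finsupp.single i a, Finsupp.smul_single s i a⟩

variable (S) in
theorem of_isLocalization (Q : Type*) [CommRing Q] [Algebra R Q] [IsLocalization S Q]
    (V : Type*) [AddCommGroup V] [Module R V] [Module Q V] [IsScalarTower R Q V] :
    IsDivisibleBy S V := by
  intro s hs x
  obtain ⟨q, hq⟩ := (IsLocalization.map_units Q ⟨s, hs⟩).exists_right_inv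
  exact ⟨q • x, by rw [← algebraMap_smul Q s, ← mul_smul, hq, one_smul]⟩

end IsDivisibleBy

section

variable {R : Type u} [CommRing R] {S : Submonoid R} {Q : Type u} [CommRing Q] [Algebra R Q]
  [IsLocalization S Q]

variable (R Q) in
theorem projective_ker_mkQ (hinj : Function.Injective (algebraMap R Q)) :
    Module.Projective R
      (LinearMap.ker (LinearMap.range (Algebra.linearMap R Q)).mkQ) := by
  rw [Submodule.ker_mkQ]
  exact Module.Projective.of_equiv (LinearEquiv.ofInjective (Algebra.linearMap R Q) hinj)

namespace Ext1Vanish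

variable {D : Type u} [AddCommGroup D] [Module R D]

theorem cokerAlg (hinj : Function.Injective (algebraMap R Q))
    (hS : ∀ s ∈ S, ∀ J : Ideal R, s ∈ J → IsPerfectRing (R ⧸ J)) (hD : IsDivisibleBy S D) :
    Ext1Vanish R (cokerAlg R Q) D := by
  have hker := projective_ker_mkQ R Q hinj
  refine of_torsion S (fun s hs J hJ => (hS s hs J hJ).hasMinimalModulo) (fun x => ?_)
    ((IsDivisibleBy.of_isLocalization S Q Q).of_surjective _ (Submodule.mkQ_surjective _))
    fun s hs => torsionBy_of_flat (hS s hs _ (Ideal.mem_span_singleton_self s))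
      (flat_torsionBy_of_surjective (IsLocalization.map_units Q ⟨s, hs⟩) _
        (Submodule.mkQ_surjective _)) (hD s hs)
  obtain ⟨q, rfl⟩ := Submodule.mkQ_surjective _ x
  obtain ⟨⟨r, s⟩, hrs⟩ := IsLocalization.surj S q
  refine ⟨s, s.2, ?_⟩
  rw [← map_smul, ← LinearMap.mem_ker, Submodule.ker_mkQ]
  exact ⟨r, by rw [Algebra.smul_def, mul_comm]; exact hrs.symm⟩

theorem of_isLocalization (hinj : Function.Injective (algebraMap R Q))
    (hS : ∀ s ∈ S, ∀ J : Ideal R, s ∈ J → IsPerfectRing (R ⧸ J)) (hD : IsDivisibleBy S D) :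
    Ext1Vanish R Q D := by
  have hker := projective_ker_mkQ R Q hinj
  exact of_extension _ (Submodule.mkQ_surjective (LinearMap.range (Algebra.linearMap R Q)))
    of_projective (cokerAlg hinj hS hD)

theorem of_forall_isDivisibleBy_prod (hinj : Function.Injective (algebraMap R Q))
    (hS : ∀ s ∈ S, ∀ J : Ideal R, s ∈ J → IsPerfectRing (R ⧸ J)) (hD : IsDivisibleBy S D) :
    Ext1Vanish R (Q × _root_.cokerAlg R Q) D :=
  (of_isLocalization hinj hS hD).prod (cokerAlg hinj hS hD)

end Ext1Vanish

variable (S Q) in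
/-- Modules in the left Ext-orthogonal of the `S`-divisible modules have projective dimension at
most one. -/
theorem projective_ker_of_ext1Vanish (hinj : Function.Injective (algebraMap R Q)) {F M : Type u}
    [AddCommGroup F] [Module R F] [Module.Projective R F] [AddCommGroup M] [Module R M]
    (h : ∀ (D : Type u) [AddCommGroup D] [Module R D], IsDivisibleBy S D → Ext1Vanish R M D)
    (π : F →ₗ[R] M) (hπ : Function.Surjective π) : Module.Projective R (LinearMap.ker π) := by
  refine Module.Projective.of_lifting_property'' fun f hf => ?_
  let ι : (LinearMap.ker π →₀ R) →ₗ[R] (LinearMap.ker π →₀ Q) :=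
    Finsupp.mapRange.linearMap (Algebra.linearMap R Q)
  have hι : Function.Injective ι := Finsupp.mapRange_injective _ (map_zero _) hinj
  let W := (LinearMap.ker f).map ι
  let φ : LinearMap.ker π →ₗ[R] ((LinearMap.ker π →₀ Q) ⧸ W) :=
    (LinearMap.ker f).liftQ (W.mkQ ∘ₗ ι) (fun x hx => by
      rw [LinearMap.mem_ker, LinearMap.comp_apply, ← LinearMap.mem_ker, Submodule.ker_mkQ]
      exact Submodule.mem_map_of_mem hx) ∘ₗ (f.quotKerEquivOfSurjective hf).symm.toLinearMap
  have hφ : ∀ x, φ (f x) = W.mkQ (ι x) := fun x => by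
    have hx : (f.quotKerEquivOfSurjective hf).symm (f x) = (LinearMap.ker f).mkQ x := by
      rw [LinearEquiv.symm_apply_eq]; rfl
    simp only [φ, LinearMap.comp_apply, LinearEquiv.coe_coe, hx]
    simp
  have hdiv : IsDivisibleBy S ((LinearMap.ker π →₀ Q) ⧸ W) :=
    ((IsDivisibleBy.of_isLocalization S Q Q).finsupp _).of_surjective _ W.mkQ_surjective
  obtain ⟨g, hg⟩ := (h _ hdiv).exists_extension (N := LinearMap.ker π) (X := F)
    (LinearMap.ker π).subtype π (Submodule.subtype_injective _) hπ
    (Submodule.range_subtype _) φ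
  obtain ⟨g', hg'⟩ := Module.projective_lifting_property W.mkQ g W.mkQ_surjective
  have key : ∀ n : LinearMap.ker π, ∃ x, ι x = g' n ∧ f x = n := fun n => by
    obtain ⟨x, hx⟩ := hf n
    have h1 : W.mkQ (g' n) = W.mkQ (ι x) := by
      rw [← hφ, hx, ← hg]
      exact LinearMap.congr_fun hg' _
    rw [← sub_eq_zero, ← map_sub, ← LinearMap.mem_ker, Submodule.ker_mkQ] at h1
    obtain ⟨k, hk, hk'⟩ := h1
    exact ⟨x + k, by rw [map_add, hk', add_sub_cancel], by
      rw [map_add, hx, LinearMap.mem_ker.1 hk, add_zero]⟩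
  choose σ hσ hσ' using key
  exact ⟨{ toFun := σ
           map_add' := fun a b => hι (by simp [hσ])
           map_smul' := fun r a => hι (by simp [hσ]) }, LinearMap.ext hσ'⟩

theorem is1Tilting_prod_cokerAlg (hinj : Function.Injective (algebraMap R Q))
    (hS : ∀ s ∈ S, ∀ J : Ideal R, s ∈ J → IsPerfectRing (R ⧸ J)) :
    Is1Tilting R (Q × cokerAlg R Q) := by
  have hQ := IsDivisibleBy.of_isLocalization S Q Q
  refine ⟨⟨_, Finsupp.linearCombination R id, Finsupp.linearCombination_id_surjective R _,
    projective_ker_of_ext1Vanish S Q hinj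
      (fun D _ _ hD => Ext1Vanish.of_forall_isDivisibleBy_prod hinj hS hD) _
      (Finsupp.linearCombination_id_surjective R _)⟩, fun ι =>
    Ext1Vanish.of_forall_isDivisibleBy_prod hinj hS
      ((hQ.prod (hQ.of_surjective _ (Submodule.mkQ_surjective _))).finsupp ι),
    ModuleCat.of R Q, ModuleCat.of R (cokerAlg R Q), Algebra.linearMap R Q, Submodule.mkQ _,
    ⟨PUnit, Finsupp.lsingle PUnit.unit ∘ₗ LinearMap.inl R Q (cokerAlg R Q),
      LinearMap.fst R Q (cokerAlg R Q) ∘ₗ Finsupp.lapply PUnit.unit, ?_⟩,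
    ⟨PUnit, Finsupp.lsingle PUnit.unit ∘ₗ LinearMap.inr R Q (cokerAlg R Q),
      LinearMap.snd R Q (cokerAlg R Q) ∘ₗ Finsupp.lapply PUnit.unit, ?_⟩,
    hinj, Submodule.mkQ_surjective _, (Submodule.ker_mkQ _).symm⟩
  · refine LinearMap.ext fun x => ?_
    simp
  · refine LinearMap.ext fun x => ?_
    simp

theorem ext1Vanish_prod_cokerAlg_iff (hinj : Function.Injective (algebraMap R Q))
    (hS : ∀ s ∈ S, ∀ J : Ideal R, s ∈ J → IsPerfectRing (R ⧸ J)) (M : Type u) [AddCommGroup M]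
    [Module R M] : Ext1Vanish R (Q × cokerAlg R Q) M ↔ IsDivisibleBy S M := by
  refine ⟨fun h s hs x => ?_, fun h => Ext1Vanish.of_forall_isDivisibleBy_prod hinj hS h⟩
  have hK : Ext1Vanish R (cokerAlg R Q) M :=
    h.of_retract (LinearMap.inr R Q _) (LinearMap.snd R Q _) fun _ => rfl
  obtain ⟨g, hg⟩ := hK.exists_extension (Algebra.linearMap R Q)
    (Submodule.mkQ _) hinj (Submodule.mkQ_surjective _) (Submodule.ker_mkQ _).symm
    (LinearMap.toSpanSingleton R M x)
  obtain ⟨q, hq⟩ := (IsLocalization.map_units Q ⟨s, hs⟩).exists_right_inv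
  refine ⟨g q, ?_⟩
  have h1 := LinearMap.congr_fun hg 1
  rw [LinearMap.comp_apply, LinearMap.toSpanSingleton_apply, one_smul, Algebra.linearMap_apply,
    map_one, ← hq, ← Algebra.smul_def, map_smul] at h1
  exact h1

end

section

variable {R : Type u} [CommRing R]

/-- Finite systems of linear equations with constants in a pure submodule are solvable in the
submodule if they are solvable in the ambient module. -/
theorem exists_solution_of_pure {A B : Type u} [AddCommGroup A] [Module R A] [AddCommGroup B]
    [Module R B] (i : A →ₗ[R] B)
    (hi : ∀ (M : Type u) [AddCommGroup M] [Module R M], Function.Injective (LinearMap.rTensor M i))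
    {J K : Type} [Fintype J] [Fintype K] (ρ : J → K → R) (a : J → A) (b : K → B)
    (h : ∀ j, ∑ k, ρ j k • b k = i (a j)) : ∃ a' : K → A, ∀ j, ∑ k, ρ j k • a' k = a j := by
  classical
  let φ : (K → R) →ₗ[R] (J → R) := Matrix.mulVecLin ρ
  have hφ : ∀ v j, φ v j = ∑ k, ρ j k * v k := fun v j => rfl
  let X := (J → R) ⧸ LinearMap.range φ
  let e : J → X := fun j => (LinearMap.range φ).mkQ (Pi.single j 1)
  have he : ∀ v : J → R, (LinearMap.range φ).mkQ v = ∑ j, v j • e j := fun v => by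
    conv_lhs => rw [pi_eq_sum_univ' v]
    simp [e, map_sum]
  have hspan : Submodule.span R (Set.range e) = ⊤ := by
    refine top_le_iff.1 fun x _ => ?_
    obtain ⟨v, rfl⟩ := Submodule.mkQ_surjective _ x
    rw [he]
    exact Submodule.sum_mem _ fun j _ => Submodule.smul_mem _ _ (Submodule.subset_span ⟨j, rfl⟩)
  have hcol : ∀ k, ∑ j, ρ j k • e j = 0 := fun k => by
    rw [← he (fun j => ρ j k), ← LinearMap.mem_ker, Submodule.ker_mkQ]
    exact ⟨Pi.single k 1, funext fun j => by simp [hφ, Pi.single_apply]⟩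
  have hzero : ∑ j, a j ⊗ₜ[R] e j = 0 := by
    refine (injective_iff_map_eq_zero _).1 (hi X) _ ?_
    rw [map_sum]
    simp only [LinearMap.rTensor_tmul, ← h, TensorProduct.sum_tmul, TensorProduct.smul_tmul]
    rw [Finset.sum_comm]
    simp only [← TensorProduct.tmul_sum, hcol, TensorProduct.tmul_zero, Finset.sum_const_zero]
  have hzero' : ∑ j, e j ⊗ₜ[R] a j = 0 := by
    have := congrArg (TensorProduct.comm R A X) hzero
    simpa using this
  obtain ⟨n, α, y, hay, hα⟩ := TensorProduct.vanishesTrivially_of_sum_tmul_eq_zero R hspan hzero'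
  have hv : ∀ l, ∃ v, φ v = fun j => α j l := fun l => by
    have h1 := hα l
    rw [← he (fun j => α j l), ← LinearMap.mem_ker, Submodule.ker_mkQ] at h1
    exact h1
  choose v hv using hv
  refine ⟨fun k => ∑ l, v l k • y l, fun j => ?_⟩
  rw [hay]
  simp only [Finset.smul_sum]
  rw [Finset.sum_comm]
  refine Finset.sum_congr rfl fun l _ => ?_
  rw [← congrFun (hv l) j, hφ, Finset.sum_smul]
  simp only [mul_smul]

variable {S : Submonoid R} {Q : Type u} [CommRing Q] [Algebra R Q] [IsLocalization S Q]

theorem exists_smul_eq_zero_cokerAlg {ι : Type*} (x : ι →₀ cokerAlg R Q) :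
    ∃ s ∈ S, s • x = 0 := by
  induction x using Finsupp.induction_linear with
  | zero => exact ⟨1, S.one_mem, smul_zero _⟩
  | add a b ha hb =>
    obtain ⟨s, hs, ha⟩ := ha
    obtain ⟨t, ht, hb⟩ := hb
    exact ⟨s * t, mul_mem hs ht, by
      rw [smul_add, mul_smul s t b, hb, mul_comm, mul_smul, ha, smul_zero, smul_zero, add_zero]⟩
  | single i x =>
    obtain ⟨q, rfl⟩ := Submodule.mkQ_surjective _ x
    obtain ⟨⟨r, s⟩, hrs⟩ := IsLocalization.surj S q
    refine ⟨s, s.2, ?_⟩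
    rw [Finsupp.smul_single, ← map_smul, Finsupp.single_eq_zero, ← LinearMap.mem_ker,
      Submodule.ker_mkQ]
    exact ⟨r, by rw [Algebra.smul_def, mul_comm]; exact hrs.symm⟩

theorem flat_torsionBy_finsupp_prod_cokerAlg (hinj : Function.Injective (algebraMap R Q)) {s : R}
    (hs : s ∈ S) (ι : Type u) : Module.Flat (R ⧸ Ideal.span {s})
      (Submodule.torsionBy R (ι →₀ Q × cokerAlg R Q) s) := by
  let p : (Q × Q) →ₗ[R] Q × cokerAlg R Q := LinearMap.prodMap LinearMap.id (Submodule.mkQ _)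
  have hp : Function.Surjective p := Function.surjective_id.prodMap (Submodule.mkQ_surjective _)
  let j : R →ₗ[R] Q × Q := LinearMap.inr R Q Q ∘ₗ Algebra.linearMap R Q
  have hj : Function.Injective j := LinearMap.inr_injective.comp hinj
  have hjp : LinearMap.ker p = LinearMap.range j := by
    ext ⟨x, y⟩
    rw [LinearMap.mem_ker]
    simp only [p, LinearMap.prodMap_apply, LinearMap.id_apply, Prod.mk_eq_zero,
      Submodule.mkQ_apply, Submodule.Quotient.mk_eq_zero]
    constructor
    · rintro ⟨rfl, r, rfl⟩
      exact ⟨r, rfl⟩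
    · rintro ⟨r, hr⟩
      exact ⟨(congrArg Prod.fst hr).symm, r, congrArg Prod.snd hr⟩
  let π : (ι →₀ Q × Q) →ₗ[R] (ι →₀ Q × cokerAlg R Q) := Finsupp.mapRange.linearMap p
  have hker : LinearMap.ker π = LinearMap.range (Finsupp.mapRange.linearMap (α := ι) j) := by
    rw [Finsupp.ker_mapRange, Finsupp.range_mapRange_linearMap _ (LinearMap.ker_eq_bot.2 hj), hjp]
  have hflat : Module.Flat R (LinearMap.ker π) := by
    rw [hker]
    exact Module.Flat.of_linearEquiv (LinearEquiv.ofInjective (Finsupp.mapRange.linearMap j)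
      (Finsupp.mapRange_injective _ (map_zero _) hj)).symm
  exact flat_torsionBy_of_surjective (IsLocalization.map_units Q ⟨s, hs⟩) π
    (Finsupp.mapRange_surjective _ (map_zero _) hp)

theorem sigmaPureSplit_prod_cokerAlg (hinj : Function.Injective (algebraMap R Q))
    (hQ : IsPerfectRing Q) (hS : ∀ s ∈ S, ∀ J : Ideal R, s ∈ J → IsPerfectRing (R ⧸ J)) :
    SigmaPureSplit R (Q × cokerAlg R Q) := by
  intro A B _ _ _ _ i hi hpure ⟨ι, f, p, hpf⟩
  have hpf : ∀ x, p (f x) = x := fun x => LinearMap.congr_fun hpf x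
  have hQdiv := IsDivisibleBy.of_isLocalization S Q Q
  have hB : IsDivisibleBy S B :=
    ((hQdiv.prod (hQdiv.of_surjective _ (Submodule.mkQ_surjective _))).finsupp ι).of_surjective p
      fun x => ⟨f x, hpf x⟩
  have hA : IsDivisibleBy S A := fun s hs a => by
    obtain ⟨b, hb⟩ := hB s hs (i a)
    obtain ⟨a', ha'⟩ := exists_solution_of_pure i hpure (fun (_ _ : Unit) => s) (fun _ => a)
      (fun _ => b) (fun _ => by simpa using hb)
    exact ⟨a' (), by simpa using ha' ()⟩
  have hBs : ∀ s ∈ S, Module.Flat (R ⧸ Ideal.span {s}) (Submodule.torsionBy R B s) := fun s hs => by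
    have := flat_torsionBy_finsupp_prod_cokerAlg hinj hs ι
    exact flat_torsionBy_of_retract s f p hpf
  have hQflat : Module.Flat R Q := IsLocalization.flat Q S
  have hQflat' : Module.Flat R (ι →₀ Q) := by
    classical
    exact Module.Flat.of_linearEquiv (finsuppLEquivDirectSum R Q ι)
  let c : B →ₗ[R] B ⧸ LinearMap.range i := (LinearMap.range i).mkQ
  have hc : Function.Surjective c := Submodule.mkQ_surjective _
  have hck : ∀ x, c x = 0 ↔ ∃ a, i a = x := fun x => by
    rw [← LinearMap.mem_ker, Submodule.ker_mkQ, LinearMap.mem_range]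
  have hCs : ∀ s ∈ S, Module.Flat (R ⧸ Ideal.span {s})
      (Submodule.torsionBy R (B ⧸ LinearMap.range i) s) := fun s hs => by
    refine flat_torsionBy_of_lift_relations s fun l r y hsy hry => ?_
    choose b hb using fun k => hc (y k)
    have h1 : ∀ k, ∃ a, i a = s • b k := fun k => by
      rw [← hck, map_smul, hb, hsy]
    have h2 : ∃ a, i a = ∑ k, r k • b k := by
      rw [← hck, map_sum]
      simpa [hb] using hry
    choose a ha using h1
    obtain ⟨a₀, ha₀⟩ := h2
    obtain ⟨a', ha'⟩ := exists_solution_of_pure i hpure (J := Option (Fin l)) (K := Fin l)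
      (fun j => j.elim r fun k => Pi.single k s) (fun j => j.elim a₀ a) b (by
        rintro (_ | j)
        · exact ha₀.symm
        · simp [Pi.single_apply, ha])
    refine ⟨B, _, _, hBs s hs, c, fun k => b k - i (a' k), fun k => ?_, fun k => ?_, ?_⟩
    · have := ha' (some k)
      simp only [Option.elim_some, Pi.single_apply, ite_smul, zero_smul,
        Finset.mem_univ, if_true, Finset.sum_ite_eq'] at this
      rw [smul_sub, ← map_smul, this, ha, sub_self]
    · rw [map_sub, hb, (hck _).2 ⟨_, rfl⟩, sub_zero]
    · have := ha' none
      simp only [Option.elim_none] at this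
      simp only [smul_sub, Finset.sum_sub_distrib, ← map_smul]
      rw [← map_sum, this, ha₀, sub_self]
  have hBQ : Module.Flat Q (Q ⊗[R] B) := by
    refine flat_baseChange_of_lift_relations S Q fun l r b hrb => ?_
    choose s hs hsb using fun k => exists_smul_eq_zero_cokerAlg (S := S)
      (Finsupp.mapRange.linearMap (LinearMap.snd R Q (cokerAlg R Q)) (f (b k)))
    let w := ∏ k, s k
    have hw : ∀ k,
        w • Finsupp.mapRange.linearMap (LinearMap.snd R Q (cokerAlg R Q)) (f (b k)) = 0 :=
      fun k => by
        obtain ⟨d, hd⟩ := Finset.dvd_prod_of_mem s (Finset.mem_univ k)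
        rw [show w = s k * d from hd, mul_comm, mul_smul, hsb, smul_zero]
    refine ⟨ι →₀ Q, inferInstance, inferInstance, inferInstance,
      p ∘ₗ Finsupp.mapRange.linearMap (LinearMap.inl R Q (cokerAlg R Q)), w, 1,
      prod_mem fun k _ => hs k, S.one_mem,
      fun k => w • Finsupp.mapRange.linearMap (LinearMap.fst R Q (cokerAlg R Q)) (f (b k)),
      fun k => ?_, ?_⟩
    · rw [LinearMap.comp_apply, ← hpf (w • b k), map_smul f]
      congr 1
      ext j
      · simp
      · have := DFunLike.congr_fun (hw k) j
        simp only [Finsupp.smul_apply, Finsupp.mapRange.linearMap_apply, Finsupp.mapRange_apply,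
          LinearMap.snd_apply, Finsupp.zero_apply] at this
        simp [this]
    · have h1 : ∀ k, r k • w • Finsupp.mapRange.linearMap (LinearMap.fst R Q (cokerAlg R Q))
          (f (b k)) = w • Finsupp.mapRange.linearMap (LinearMap.fst R Q (cokerAlg R Q))
          (f (r k • b k)) := fun k => by
        rw [smul_comm, map_smul f]
        exact congrArg _ (map_smul _ (r k) _).symm
      rw [Finset.sum_congr rfl fun k _ => h1 k, ← Finset.smul_sum, ← map_sum, ← map_sum, hrb]
      simp
  have hCQ : Module.Flat Q (Q ⊗[R] (B ⧸ LinearMap.range i)) := by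
    refine flat_baseChange_of_lift_relations S Q fun l r y hry => ?_
    choose b hb using fun k => hc (y k)
    have h2 : ∃ a, i a = ∑ k, r k • b k := by
      rw [← hck, map_sum]
      simpa [hb] using hry
    obtain ⟨a₀, ha₀⟩ := h2
    obtain ⟨a', ha'⟩ := exists_solution_of_pure i hpure (J := Unit) (K := Fin l)
      (fun _ => r) (fun _ => a₀) b fun _ => ha₀.symm
    refine ⟨B, inferInstance, inferInstance, hBQ, c, 1, 1, S.one_mem, S.one_mem,
      fun k => b k - i (a' k), fun k => ?_, ?_⟩
    · rw [map_sub, hb, (hck _).2 ⟨_, rfl⟩, sub_zero, one_smul]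
    · simp only [smul_sub, Finset.sum_sub_distrib, ← map_smul]
      rw [← map_sum, ha' (), ha₀, sub_self]
  have hC : Ext1Vanish R (B ⧸ LinearMap.range i) A :=
    Ext1Vanish.of_flat_baseChange hQ hS (Ext1Vanish.of_isLocalization hinj hS hA)
      (hB.of_surjective c hc) hA hCs hCQ
  exact hC.exists_extension i c hi hc (Submodule.ker_mkQ _).symm LinearMap.id

end

section

variable {R : Type u} [CommRing R] {S : Submonoid R} {Q : Type u} [CommRing Q] [Algebra R Q]
  [IsLocalization S Q]

variable (S Q) in
theorem projective_baseChange_of_ext1Vanish {M : Type u} [AddCommGroup M] [Module R M]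
    (h : ∀ (D : Type u) [AddCommGroup D] [Module R D], IsDivisibleBy S D → Ext1Vanish R M D) :
    Module.Projective Q (Q ⊗[R] M) := by
  refine Module.Projective.of_lifting_property'' fun f hf => ?_
  obtain ⟨g, hg⟩ := (h (LinearMap.ker f)
    (IsDivisibleBy.of_isLocalization S Q (LinearMap.ker f))).exists_lift
    ((LinearMap.ker f).subtype.restrictScalars R) (f.restrictScalars R)
    (Submodule.subtype_injective _) hf (by ext x; simp) (TensorProduct.mk R Q M 1)
  refine ⟨LinearMap.liftBaseChange Q g, TensorProduct.AlgebraTensorModule.curry_injective ?_⟩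
  ext x
  have := LinearMap.congr_fun hg x
  simpa using this

/-- A finite set of elements of a direct limit has a simultaneous lift. -/
theorem exists_section_directLimit {ι : Type u} [Preorder ι] [IsDirected ι (· ≤ ·)] [Nonempty ι]
    [DecidableEq ι] {M : ι → Type u} [∀ i, AddCommGroup (M i)] [∀ i, Module R (M i)]
    {f : ∀ i j, i ≤ j → M i →ₗ[R] M j} (F : Finset (Module.DirectLimit M f)) :
    ∃ (i : ι) (σ : Module.DirectLimit M f → M i),
      ∀ m ∈ F, Module.DirectLimit.of R ι M f i (σ m) = m := by
  classical
  choose k x hx using fun m : Module.DirectLimit M f => Module.DirectLimit.exists_of m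
  obtain ⟨i, hi⟩ := Finset.exists_le (F.image k)
  refine ⟨i, fun m => if h : m ∈ F then f (k m) i (hi _ (Finset.mem_image_of_mem k h)) (x m) else 0,
    fun m hm => ?_⟩
  simp only [dif_pos hm]
  rw [Module.DirectLimit.of_f, hx]

section DirectLimit

variable {ι : Type u} [Preorder ι] [IsDirected ι (· ≤ ·)] [Nonempty ι] [DecidableEq ι]
  {M : ι → Type u} [∀ i, AddCommGroup (M i)] [∀ i, Module R (M i)]
  {f : ∀ i j, i ≤ j → M i →ₗ[R] M j} [DirectedSystem M fun i j h => f i j h]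

theorem exists_map_eq_zero_directLimit {l : ℕ} {i : ι} (x : Fin l → M i)
    (hx : ∀ k, Module.DirectLimit.of R ι M f i (x k) = 0) :
    ∃ (j : ι) (hij : i ≤ j), ∀ k, f i j hij (x k) = 0 := by
  classical
  choose j hij hj using fun k => Module.DirectLimit.of.zero_exact (hx k)
  obtain ⟨b, hb⟩ := Finset.exists_le (insert i (Finset.univ.image j))
  refine ⟨b, hb i (Finset.mem_insert_self _ _), fun k => ?_⟩
  have hjb : j k ≤ b :=
    hb _ (Finset.mem_insert_of_mem (Finset.mem_image_of_mem j (Finset.mem_univ k)))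
  have := DirectedSystem.map_map (f := fun i j h => f i j h) (hij k) hjb (x k)
  rw [← this, hj, map_zero]

theorem flat_ker_directLimit (h : ∀ i, Module.Flat R
      (LinearMap.ker (Finsupp.linearCombination R (id : M i → M i)))) :
    Module.Flat R (LinearMap.ker (Finsupp.linearCombination R
      (id : Module.DirectLimit M f → Module.DirectLimit M f))) := by
  classical
  have hmap : ∀ {A B : Type u} [AddCommGroup A] [Module R A] [AddCommGroup B] [Module R B]
      (g : A →ₗ[R] B) (x : A →₀ R), Finsupp.linearCombination R (id : B → B)
        (Finsupp.lmapDomain R R g x) = g (Finsupp.linearCombination R id x) := by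
    intro A B _ _ _ _ g x
    induction x using Finsupp.induction_linear with
    | zero => simp
    | add a b ha hb => simp only [map_add, ha, hb]
    | single a r => simp
  refine flat_of_lift_relations.{u} (A := R) (N := LinearMap.ker (Finsupp.linearCombination R
    (id : Module.DirectLimit M f → Module.DirectLimit M f))) ?_
  intro l r n hrn
  obtain ⟨i, σ, hσ⟩ := exists_section_directLimit (R := R) (f := f)
    (Finset.univ.biUnion fun k => (n k).1.support)
  have hσn : ∀ k, Finsupp.lmapDomain R R (Module.DirectLimit.of R ι M f i)
      (Finsupp.lmapDomain R R σ (n k).1) = n k := fun k => by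
    simp only [Finsupp.lmapDomain_apply]
    rw [← Finsupp.mapDomain_comp]
    conv_rhs => rw [← Finsupp.mapDomain_id (v := (n k).1)]
    exact Finsupp.mapDomain_congr fun m hm =>
      hσ m (Finset.mem_biUnion.2 ⟨k, Finset.mem_univ k, hm⟩)
  obtain ⟨j, hij, hj⟩ := exists_map_eq_zero_directLimit
    (fun k => Finsupp.linearCombination R id (Finsupp.lmapDomain R R σ (n k).1)) fun k => by
      rw [← hmap, hσn]
      exact (n k).2
  refine ⟨LinearMap.ker (Finsupp.linearCombination R (id : M j → M j)), inferInstance,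
    inferInstance, h j,
    (Finsupp.lmapDomain R R (Module.DirectLimit.of R ι M f j)).restrict fun x hx => ?_,
    fun k => ⟨Finsupp.lmapDomain R R (f i j hij) (Finsupp.lmapDomain R R σ (n k).1), ?_⟩,
    fun k => Subtype.ext ?_, Subtype.ext ?_⟩
  · rw [LinearMap.mem_ker, hmap, LinearMap.mem_ker.1 hx, map_zero]
  · rw [LinearMap.mem_ker, hmap, hj]
  · rw [← hσn k]
    simp only [LinearMap.restrict_apply, Finsupp.lmapDomain_apply]
    rw [← Finsupp.mapDomain_comp, ← Finsupp.mapDomain_comp, ← Finsupp.mapDomain_comp]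
    congr 1
    funext m
    simp
  · have h1 := congrArg (fun x => Finsupp.lmapDomain R R (f i j hij)
      (Finsupp.lmapDomain R R σ x.1)) hrn
    simpa using h1

end DirectLimit

theorem Ext1Vanish.directLimit (hinj : Function.Injective (algebraMap R Q))
    (hQ : IsPerfectRing Q) (hS : ∀ s ∈ S, ∀ J : Ideal R, s ∈ J → IsPerfectRing (R ⧸ J))
    {ι : Type u} [Preorder ι] [IsDirected ι (· ≤ ·)] [Nonempty ι] [DecidableEq ι]
    (M : ι → Type u) [∀ i, AddCommGroup (M i)] [∀ i, Module R (M i)]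
    (f : ∀ i j, i ≤ j → M i →ₗ[R] M j) [DirectedSystem M fun i j h => f i j h]
    (h : ∀ i, ∀ (D : Type u) [AddCommGroup D] [Module R D], IsDivisibleBy S D →
      Ext1Vanish R (M i) D)
    {D : Type u} [AddCommGroup D] [Module R D] (hD : IsDivisibleBy S D) :
    Ext1Vanish R (Module.DirectLimit M f) D := by
  let L := Module.DirectLimit M f
  let π : (L →₀ R) →ₗ[R] L := Finsupp.linearCombination R id
  have hπ : Function.Surjective π := Finsupp.linearCombination_id_surjective R L
  have hNflat : Module.Flat R (LinearMap.ker π) := flat_ker_directLimit fun i => by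
    have := projective_ker_of_ext1Vanish S Q hinj (h i) _
      (Finsupp.linearCombination_id_surjective R (M i))
    infer_instance
  let emb : (L →₀ R) →ₗ[R] (L →₀ Q) := Finsupp.mapRange.linearMap (Algebra.linearMap R Q)
  have hemb : Function.Injective emb := Finsupp.mapRange_injective _ (map_zero _) hinj
  let W : Submodule R (L →₀ Q) := (LinearMap.ker π).map emb
  have hWmem : ∀ x, W.mkQ (emb x) = 0 ↔ π x = 0 := fun x => by
    rw [← LinearMap.mem_ker, Submodule.ker_mkQ]
    exact hemb.mem_set_image
  have hWflat : Module.Flat R (LinearMap.ker W.mkQ) := by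
    rw [Submodule.ker_mkQ]
    exact Module.Flat.of_linearEquiv (Submodule.equivMapOfInjective emb hemb _).symm
  let η : L →ₗ[R] ((L →₀ Q) ⧸ W) :=
    (LinearMap.ker π).liftQ (W.mkQ ∘ₗ emb) (fun x hx => (hWmem x).2 hx) ∘ₗ
      (π.quotKerEquivOfSurjective hπ).symm.toLinearMap
  have hη : ∀ x, η (π x) = W.mkQ (emb x) := fun x => by
    have hx : (π.quotKerEquivOfSurjective hπ).symm (π x) = (LinearMap.ker π).mkQ x := by
      rw [LinearEquiv.symm_apply_eq]; rfl
    simp only [η, LinearMap.comp_apply, LinearEquiv.coe_coe, hx]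
    exact Submodule.liftQ_apply _ _ x
  have hdiv : IsDivisibleBy S ((L →₀ Q) ⧸ W) :=
    ((IsDivisibleBy.of_isLocalization S Q Q).finsupp _).of_surjective _ W.mkQ_surjective
  have hflatQ : Module.Flat Q (Q ⊗[R] ((L →₀ Q) ⧸ W)) := by
    refine flat_baseChange_of_lift_relations S Q fun l r c hrc => ?_
    choose v hv using fun k => W.mkQ_surjective (c k)
    obtain ⟨u, hu⟩ := IsLocalizedModule.exist_integer_multiples_of_finite S emb v
    choose x hx using hu
    have hx : ∀ k, emb (x k) = u.1 • v k := hx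
    have h1 : π (∑ k, r k • x k) = 0 := by
      have h2 : ∀ k, W.mkQ (emb (r k • x k)) = u.1 • r k • c k := fun k => by
        rw [map_smul, hx, map_smul, map_smul, hv, smul_comm]
      rw [← hWmem, map_sum, map_sum, Finset.sum_congr rfl fun k _ => h2 k, ← Finset.smul_sum, hrc,
        smul_zero]
    classical
    obtain ⟨i, σ, hσ⟩ := exists_section_directLimit (Finset.univ.image fun k => π (x k))
    have hσ : ∀ k, Module.DirectLimit.of R ι M f i (σ (π (x k))) = π (x k) := fun k =>
      hσ _ (Finset.mem_image_of_mem _ (Finset.mem_univ k))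
    obtain ⟨j, hij, hj⟩ := exists_map_eq_zero_directLimit (R := R) (f := f) (l := 1)
      (fun _ => ∑ k, r k • σ (π (x k))) fun _ => by
        rw [map_sum, ← h1, map_sum]
        simp only [map_smul, hσ]
    have := projective_baseChange_of_ext1Vanish S Q (h j)
    refine ⟨M j, inferInstance, inferInstance, inferInstance,
      η ∘ₗ Module.DirectLimit.of R ι M f j, u, 1, u.2, S.one_mem, fun k => f i j hij (σ (π (x k))),
      fun k => ?_, ?_⟩
    · rw [LinearMap.comp_apply, Module.DirectLimit.of_f, hσ, hη, hx, map_smul, hv]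
    · have := hj 0
      rw [map_sum] at this
      simpa using this
  have hD0 : Ext1Vanish R ((L →₀ Q) ⧸ W) D :=
    of_flat_baseChange hQ hS (of_isLocalization hinj hS hD) hdiv hD
      (fun s hs => flat_torsionBy_of_surjective (IsLocalization.map_units Q ⟨s, hs⟩) W.mkQ
        W.mkQ_surjective) hflatQ
  refine of_forall_extension of_projective π hπ fun φ => ?_
  obtain ⟨g, hg⟩ := hD0.exists_extension (N := LinearMap.ker π) (X := L →₀ Q)
    (emb ∘ₗ (LinearMap.ker π).subtype) W.mkQ (hemb.comp (Submodule.subtype_injective _))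
    W.mkQ_surjective (by
      rw [Submodule.ker_mkQ, LinearMap.range_comp, Submodule.range_subtype]) φ
  exact ⟨g ∘ₗ emb, fun x => LinearMap.congr_fun hg x⟩

end

namespace GabrielTopology

section

variable {R : Type u} [CommRing R] {G : GabrielTopology R} {Q : Type u} [CommRing Q] [Algebra R Q]

namespace IsRingOfQuotients

theorem algebraMap_injective (h : G.IsRingOfQuotients Q) (hG : G.Faithful) :
    Function.Injective (algebraMap R Q) :=
  (injective_iff_map_eq_zero _).2 fun r hr => hG r (h.ker_torsion r hr)

theorem map_eq_top (h : G.IsRingOfQuotients Q) (hQ : IsPerfectRing Q) {J : Ideal R}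
    (hJ : J ∈ G.sets) : J.map (algebraMap R Q) = ⊤ :=
  hQ.hasMinimalModulo_bot.eq_top_of_annihilator _ fun x hx =>
    h.torsionFree x <| G.mem_of_le hJ fun j hj => by
      rw [Ideal.mem_torsionOf_iff, Algebra.smul_def, mul_comm]
      exact hx _ (Ideal.mem_map_of_mem _ hj)

/-- If the ring of quotients is perfect, every ideal of `G` contains an element becoming a unit. -/
theorem exists_isUnit (h : G.IsRingOfQuotients Q) (hQ : IsPerfectRing Q) {J : Ideal R}
    (hJ : J ∈ G.sets) : ∃ s ∈ J, IsUnit (algebraMap R Q s) := by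
  by_contra! hne
  have hfin := hQ.hasMinimalModulo_bot.finite_maximal
  have hsub : (J : Set R) ⊆ ⋃ m ∈ (↑hfin.toFinset : Set (Ideal Q)), m.comap (algebraMap R Q) := by
    intro s hs
    obtain ⟨m, hm, hsm⟩ := exists_max_ideal_of_mem_nonunits (hne s hs)
    exact Set.mem_biUnion (by simpa using hm) hsm
  obtain ⟨m, hm, hle⟩ := (Ideal.subset_union_prime ⊥ ⊥ fun (m : Ideal Q) hm _ _ =>
    have : m.IsMaximal := by simpa using hm
    m.comap_isPrime (algebraMap R Q)).1 hsub
  have hm : m.IsMaximal := by simpa using hm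
  exact hm.ne_top (top_le_iff.1 ((h.map_eq_top hQ hJ).symm.trans_le
    (Ideal.map_le_iff_le_comap.2 hle)))

theorem span_singleton_mem (h : G.IsRingOfQuotients Q) (hG : G.Faithful) {s : R}
    (hs : IsUnit (algebraMap R Q s)) : Ideal.span {s} ∈ G.sets := by
  obtain ⟨q, hq⟩ := hs.exists_right_inv
  obtain ⟨J, hJ, hJq⟩ := h.coker_torsion q
  refine G.mem_of_le hJ fun x hx => ?_
  obtain ⟨r, hr⟩ := hJq x hx
  refine Ideal.mem_span_singleton.2 ⟨r, h.algebraMap_injective hG ?_⟩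
  rw [map_mul, ← hr, Algebra.smul_def, mul_left_comm, hq, mul_one]

theorem isLocalization (h : G.IsRingOfQuotients Q) (hG : G.Faithful) (hQ : IsPerfectRing Q) :
    IsLocalization ((IsUnit.submonoid Q).comap (algebraMap R Q)) Q where
  map_units s := s.2
  surj q := by
    obtain ⟨J, hJ, hJq⟩ := h.coker_torsion q
    obtain ⟨s, hs, hu⟩ := h.exists_isUnit hQ hJ
    obtain ⟨r, hr⟩ := hJq s hs
    exact ⟨(r, ⟨s, hu⟩), by rw [← hr, Algebra.smul_def, mul_comm]⟩
  exists_of_eq hxy := ⟨1, by rw [h.algebraMap_injective hG hxy]⟩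

theorem isDivisible_iff (h : G.IsRingOfQuotients Q) (hG : G.Faithful) (hQ : IsPerfectRing Q)
    (M : Type u) [AddCommGroup M] [Module R M] :
    IsDivisibleBy ((IsUnit.submonoid Q).comap (algebraMap R Q)) M ↔ G.IsDivisible M := by
  refine ⟨fun hM J hJ => ?_, fun hM s hs x => ?_⟩
  · obtain ⟨s, hs, hu⟩ := h.exists_isUnit hQ hJ
    refine eq_top_iff.2 fun x _ => ?_
    obtain ⟨y, rfl⟩ := hM s hu x
    exact Submodule.smul_mem_smul hs trivial
  · have hx : x ∈ Ideal.span {s} • (⊤ : Submodule R M) := by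
      rw [hM _ (h.span_singleton_mem hG hs)]
      trivial
    rw [Submodule.ideal_span_singleton_smul] at hx
    obtain ⟨y, -, hy⟩ := Submodule.mem_smul_pointwise_iff_exists _ _ _ |>.1 hx
    exact ⟨y, hy⟩

end IsRingOfQuotients

end

section Existence

variable {R : Type u} [CommRing R] (G : GabrielTopology R)

theorem mem_of_forall_exists {I J : Ideal R} (hJ : J ∈ G.sets)
    (h : ∀ r ∈ J, ∃ K ∈ G.sets, ∀ a ∈ K, a * r ∈ I) : I ∈ G.sets := by
  refine G.gabriel I J hJ fun r hr => ?_
  obtain ⟨K, hK, hKI⟩ := h r hr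
  refine G.mem_of_le hK fun a ha => Submodule.mem_colon.2 fun x hx => ?_
  obtain ⟨c, rfl⟩ := Ideal.mem_span_singleton.1 hx
  rw [smul_eq_mul, ← mul_assoc]
  exact I.mul_mem_right _ (hKI a ha)

/-- The `G`-torsion submodule. -/
def torsion (M : Type u) [AddCommGroup M] [Module R M] : Submodule R M where
  carrier := {x | Ideal.torsionOf R M x ∈ G.sets}
  zero_mem' := by simpa using G.top_mem
  add_mem' {x y} hx hy := G.mem_of_le (G.inf_mem hx hy) fun a ha => by
    rw [Ideal.mem_torsionOf_iff, smul_add, (Ideal.mem_torsionOf_iff x a).1 ha.1,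
      (Ideal.mem_torsionOf_iff y a).1 ha.2, add_zero]
  smul_mem' r x hx := G.mem_of_le hx fun a ha => by
    rw [Ideal.mem_torsionOf_iff, smul_comm, (Ideal.mem_torsionOf_iff x a).1 ha, smul_zero]

variable {G}

theorem mem_torsion_of_forall {M : Type u} [AddCommGroup M] [Module R M] {x : M} {J : Ideal R}
    (hJ : J ∈ G.sets) (h : ∀ a ∈ J, a • x ∈ G.torsion M) : x ∈ G.torsion M :=
  G.mem_of_forall_exists hJ fun r hr => ⟨_, h r hr, fun a ha => by
    rwa [Ideal.mem_torsionOf_iff, mul_smul]⟩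

theorem map_mem_torsion {M N : Type u} [AddCommGroup M] [Module R M] [AddCommGroup N] [Module R N]
    (f : M →ₗ[R] N) {x : M} (hx : x ∈ G.torsion M) : f x ∈ G.torsion N :=
  G.mem_of_le hx fun a ha => by
    rw [Ideal.mem_torsionOf_iff, ← map_smul, (Ideal.mem_torsionOf_iff x a).1 ha, map_zero]

theorem isTorsionFree_quotient_torsion (M : Type u) [AddCommGroup M] [Module R M] :
    G.IsTorsionFree (M ⧸ G.torsion M) := fun x hx => by
  obtain ⟨x, rfl⟩ := Submodule.mkQ_surjective _ x
  refine (Submodule.Quotient.mk_eq_zero _).2 (mem_torsion_of_forall hx fun a ha => ?_)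
  exact (Submodule.Quotient.mk_eq_zero _).1 ha

/-- A `G`-closed module containing `R` with torsion cokernel, in which every element is the image
of `1` under an endomorphism, yields a ring of quotients as its endomorphism ring. -/
theorem exists_isRingOfQuotients_of_module {W : Type u} [AddCommGroup W] [Module R W]
    (ψ : R →ₗ[R] W) (htf : G.IsTorsionFree W)
    (hinj : ∀ J ∈ G.sets, ∀ f : ↥J →ₗ[R] W, ∃ w : W, ∀ j : ↥J, f j = (j : R) • w)
    (hker : ∀ r, ψ r = 0 → Ideal.torsionOf R R r ∈ G.sets)
    (hcoker : ∀ w, ∃ J ∈ G.sets, ∀ x ∈ J, ∃ r : R, x • w = ψ r)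
    (hext : ∀ w, ∃ g : W →ₗ[R] W, g (ψ 1) = w) :
    ∃ (Q : Type u) (_ : CommRing Q) (_ : Algebra R Q), G.IsRingOfQuotients Q := by
  have hψ : ∀ r, ψ r = r • ψ 1 := fun r => by rw [← map_smul, smul_eq_mul, mul_one]
  have htf' : ∀ {x : W} {J : Ideal R}, J ∈ G.sets → (∀ a ∈ J, a • x = 0) → x = 0 :=
    fun hJ h => htf _ (G.mem_of_le hJ h)
  have hev : ∀ g h : Module.End R W, g (ψ 1) = h (ψ 1) → g = h := fun g h hgh => by
    ext w
    obtain ⟨J, hJ, hw⟩ := hcoker w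
    refine sub_eq_zero.1 (htf' hJ fun a ha => ?_)
    obtain ⟨r, hr⟩ := hw a ha
    rw [smul_sub, ← map_smul, ← map_smul, hr, hψ, map_smul, map_smul, hgh, sub_self]
  have hcomm : ∀ g h : Module.End R W, g * h = h * g := fun g h => hev _ _ <| by
    obtain ⟨J, hJ, hw⟩ := hcoker (h (ψ 1))
    obtain ⟨J', hJ', hw'⟩ := hcoker (g (ψ 1))
    refine sub_eq_zero.1 (htf' hJ fun a ha => htf' hJ' fun a' ha' => ?_)
    obtain ⟨r, hr⟩ := hw a ha
    obtain ⟨r', hr'⟩ := hw' a' ha'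
    have h1 : a' • a • g (h (ψ 1)) = r • r' • ψ 1 := by
      rw [← map_smul, hr, hψ, map_smul, smul_comm, hr', hψ r']
    have h2 : a' • a • h (g (ψ 1)) = r • r' • ψ 1 := by
      rw [smul_comm, ← map_smul, hr', hψ, map_smul, smul_comm, hr, hψ r, smul_comm]
    rw [smul_sub, smul_sub, Module.End.mul_apply, Module.End.mul_apply, h1, h2, sub_self]
  let _ : CommRing (Module.End R W) := { (inferInstance : Ring (Module.End R W)) with
    mul_comm := hcomm }
  refine ⟨Module.End R W, inferInstance, inferInstance, ?_, ?_, ?_, ?_⟩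
  · intro q hq
    ext w
    exact htf' hq fun a ha => LinearMap.congr_fun ha w
  · intro J hJ f
    obtain ⟨w, hw⟩ := hinj J hJ (LinearMap.applyₗ (ψ 1) ∘ₗ f)
    obtain ⟨g, rfl⟩ := hext w
    exact ⟨g, fun j => hev _ _ (hw j)⟩
  · intro r hr
    refine hker r ?_
    rw [hψ]
    exact LinearMap.congr_fun hr (ψ 1)
  · intro q
    obtain ⟨J, hJ, hw⟩ := hcoker (q (ψ 1))
    refine ⟨J, hJ, fun x hx => ?_⟩
    obtain ⟨r, hr⟩ := hw x hx
    exact ⟨r, hev _ _ (hr.trans (hψ r))⟩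

theorem Faithful.exists_isRingOfQuotients (hG : G.Faithful) :
    ∃ (Q : Type u) (_ : CommRing Q) (_ : Algebra R Q), G.IsRingOfQuotients Q := by
  obtain ⟨E, _, i₀, _⟩ := (inferInstance :
    CategoryTheory.EnoughInjectives (ModuleCat.{u} R)).presentation (ModuleCat.of R R)
  have hE : Module.Injective R E := Module.injective_module_of_injective_object R E
  let i : R →ₗ[R] E := i₀.hom
  have hi : Function.Injective i := (ModuleCat.mono_iff_injective i₀).1 inferInstance
  let V : Submodule R E := (G.torsion (E ⧸ LinearMap.range i)).comap (LinearMap.range i).mkQ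
  have hV : ∀ {x : E}, x ∈ V → ∃ J ∈ G.sets, ∀ a ∈ J, ∃ r, a • x = i r := fun {x} hx =>
    ⟨_, hx, fun a ha => by
      obtain ⟨r, hr⟩ := (Submodule.Quotient.mk_eq_zero (LinearMap.range i) (x := a • x)).1 ha
      exact ⟨r, hr.symm⟩⟩
  have hiV : ∀ r, i r ∈ V := fun r => by
    have : (LinearMap.range i).mkQ (i r) = 0 := by simp
    rw [Submodule.mem_comap, this]
    exact zero_mem _
  have hVmem : ∀ {x : E} {J : Ideal R}, J ∈ G.sets → (∀ a ∈ J, a • x ∈ V) → x ∈ V :=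
    fun hJ h => mem_torsion_of_forall hJ h
  let j : R →ₗ[R] V := i.codRestrict V hiV
  let π := (G.torsion V).mkQ
  have hπ : Function.Surjective π := Submodule.mkQ_surjective _
  have hjt : ∀ r, π (j r) = 0 → r = 0 := fun r hr => hG r <|
    G.mem_of_le ((Submodule.Quotient.mk_eq_zero (G.torsion V)).1 hr) fun a ha => by
      have ha : a • j r = 0 := ha
      rw [← map_smul] at ha
      exact hi ((congrArg Subtype.val ha).trans (map_zero i).symm)
  have hinj : Function.Injective (π ∘ₗ j) := (injective_iff_map_eq_zero _).2 hjt
  have htf := isTorsionFree_quotient_torsion (G := G) V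
  have hcoker : ∀ w, ∃ J ∈ G.sets, ∀ x ∈ J, ∃ r : R, x • w = (π ∘ₗ j) r := fun w => by
    obtain ⟨x, rfl⟩ := hπ w
    obtain ⟨J, hJ, h⟩ := hV x.2
    refine ⟨J, hJ, fun a ha => ?_⟩
    obtain ⟨r, hr⟩ := h a ha
    exact ⟨r, congrArg π (Subtype.ext hr : a • x = j r)⟩
  refine exists_isRingOfQuotients_of_module (π ∘ₗ j) htf (fun J hJ f => ?_)
    (fun r hr => ?_) hcoker fun w => ?_
  · let P : Submodule R J := (LinearMap.range (π ∘ₗ j)).comap f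
    let ρ : P →ₗ[R] R := (LinearEquiv.ofInjective _ hinj).symm.toLinearMap ∘ₗ
      f.restrict (p := P) (q := LinearMap.range (π ∘ₗ j)) fun _ hx => hx
    have hρ : ∀ x : P, π (j (ρ x)) = f x := fun x =>
      congrArg Subtype.val ((LinearEquiv.ofInjective _ hinj).apply_symm_apply _)
    obtain ⟨g, hg⟩ := hE.out (J.subtype ∘ₗ P.subtype)
      ((Submodule.subtype_injective _).comp (Submodule.subtype_injective _)) (i ∘ₗ ρ)
    have hg : ∀ x : P, (x : R) • g 1 = i (ρ x) := fun x => by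
      rw [← map_smul, smul_eq_mul, mul_one]
      exact hg x
    have hPG : P.map J.subtype ∈ G.sets := G.mem_of_forall_exists hJ fun r hr => by
      obtain ⟨K, hK, h⟩ := hcoker (f ⟨r, hr⟩)
      refine ⟨K, hK, fun a ha => ⟨a • ⟨r, hr⟩, ?_, rfl⟩⟩
      obtain ⟨b, hb⟩ := h a ha
      exact ⟨b, by rw [map_smul, hb]⟩
    have hgV : g 1 ∈ V := hVmem hPG fun a ha => by
      obtain ⟨x, hx, rfl⟩ := ha
      have := hg ⟨x, hx⟩
      exact this ▸ hiV _
    refine ⟨π ⟨g 1, hgV⟩, fun y => ?_⟩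
    obtain ⟨K, hK, h⟩ := hcoker (f y)
    refine sub_eq_zero.1 (htf _ (G.mem_of_le hK fun a ha => ?_))
    obtain ⟨b, hb⟩ := h a ha
    have hx : a • y ∈ P := ⟨b, by rw [map_smul, hb]⟩
    have h1 : (a * (y : R)) • (⟨g 1, hgV⟩ : V) = j (ρ ⟨a • y, hx⟩) := Subtype.ext (hg ⟨a • y, hx⟩)
    rw [Ideal.mem_torsionOf_iff, smul_sub, smul_smul, ← map_smul π, h1, hρ, map_smul, sub_self]
  · rw [hjt r hr]
    simpa using G.top_mem
  · obtain ⟨x, rfl⟩ := hπ w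
    obtain ⟨e, he⟩ := hE.out i hi (LinearMap.toSpanSingleton R E x)
    have heV : ∀ y ∈ V, e y ∈ V := fun y hy => by
      obtain ⟨J, hJ, h⟩ := hV hy
      refine hVmem hJ fun a ha => ?_
      obtain ⟨r, hr⟩ := h a ha
      rw [← map_smul, hr, he]
      exact V.smul_mem r x.2
    refine ⟨(G.torsion V).mapQ _ (e.restrict heV) fun y hy => map_mem_torsion _ hy, ?_⟩
    refine congrArg π (Subtype.ext ?_)
    exact (he 1).trans (one_smul R _)

end Existence

end GabrielTopology

theorem stmt2 (R : Type u) [CommRing R] (G : GabrielTopology R)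
    (hG : G.IsTiltingTopology)
    (hRG : ∀ (Q : Type u) [CommRing Q] [Algebra R Q], G.IsRingOfQuotients Q → IsPerfectRing Q)
    (hRJ : ∀ J ∈ G.sets, IsPerfectRing (R ⧸ J)) :
    (∀ (Q : Type u) [CommRing Q] [Algebra R Q], G.IsRingOfQuotients Q →
      Is1Tilting R (Q × cokerAlg R Q) ∧
      (∀ (M : Type u) [AddCommGroup M] [Module R M],
        Ext1Vanish R (Q × cokerAlg R Q) M ↔ G.IsDivisible M) ∧
      SigmaPureSplit R (Q × cokerAlg R Q)) ∧
    G.AClosedUnderDirectLimits := by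
  have hS : ∀ (Q : Type u) [CommRing Q] [Algebra R Q], G.IsRingOfQuotients Q →
      ∀ s ∈ (IsUnit.submonoid Q).comap (algebraMap R Q), ∀ J : Ideal R, s ∈ J →
        IsPerfectRing (R ⧸ J) := fun Q _ _ h s hs J hsJ =>
    hRJ J (G.mem_of_le (h.span_singleton_mem hG.1 hs) ((Ideal.span_singleton_le_iff_mem J).2 hsJ))
  refine ⟨fun Q _ _ h => ?_, fun ι _ _ _ _ M _ _ f _ hM D _ _ hD => ?_⟩
  · have := h.isLocalization hG.1 (hRG Q h)
    have hinj := h.algebraMap_injective hG.1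
    exact ⟨is1Tilting_prod_cokerAlg hinj (hS Q h),
      fun M _ _ => (ext1Vanish_prod_cokerAlg_iff hinj (hS Q h) M).trans
        (h.isDivisible_iff hG.1 (hRG Q h) M),
      sigmaPureSplit_prod_cokerAlg hinj (hRG Q h) (hS Q h)⟩
  · obtain ⟨Q, _, _, h⟩ := hG.1.exists_isRingOfQuotients
    have := h.isLocalization hG.1 (hRG Q h)
    exact Ext1Vanish.directLimit (h.algebraMap_injective hG.1) (hRG Q h) (hS Q h) M f
      (fun i D _ _ hD => hM i D ((h.isDivisible_iff hG.1 (hRG Q h) D).1 hD))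
      ((h.isDivisible_iff hG.1 (hRG Q h) D).2 hD)
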